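/- arXiv:math/0612431 — 2 statements merged into one kernel-verified Lean document; each statement's English description precedes it below -/
import Mathlib

section
/- For every m,n ≥ 1, the cohomology of the polydifferential Gerstenhaber–Schack complex of B in bidegree (m,n) is isomorphic to Hom_k(Λ^m W, Λ^n W). More precisely: for every Γ ∈ Hom_poly(B^{⊗m}, B^{⊗n}) with d₁Γ = 0 and d₂Γ = 0 there exist a unique f ∈ Hom_k(Λ^m W, Λ^n W) and elements Γ′ ∈ Hom_poly(B^{⊗(m−1)}, B^{⊗n}) (taken to be 0 if m = 1) and Γ″ ∈ Hom_poly(B^{⊗m}, B^{⊗(n−1)}) (taken to be 0 if n = 1) such that Γ = F₁(f) + d₁Γ′ + d₂Γ″. In particular, the total cohomology of (⊕_{m,n≥1} Hom_poly(B^{⊗m}, B^{⊗n}), d_gs) is isomorphic to ⊕_{m,n≥1} Hom_k(Λ^m W, Λ^n W), the bialgebra analogue of the Kostant–Hochschild–Rosenberg theorem (Corollary 4.9 of the paper). -/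
noncomputable section

open MvPolynomial

namespace GS

variable (k : Type) [Field k] [CharZero k] (N : ℕ)

/-- Model of `B^{⊗n}` where `B = k[x¹,…,x^N]`: polynomials in `n` groups ("slots")
of `N` variables; the slot-`t` variables model the `t`-th tensor factor. -/
abbrev Pn (n : ℕ) : Type := MvPolynomial (Fin n × Fin N) k

/-- The iterated comultiplication `Δ^{n-1} : B → B^{⊗n}`, the algebra map `x_i ↦ Σ_t x_{(t,i)}`. -/
def Δiter (n : ℕ) : MvPolynomial (Fin N) k →ₐ[k] Pn k N n :=
  MvPolynomial.aeval fun i => ∑ t : Fin n, MvPolynomial.X (t, i)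

/-- The algebra map `B^{⊗m} → B^{⊗n}` applying `Δ^{n-1}` to every tensor factor and
multiplying the results in `B^{⊗n}`. -/
def spread (m n : ℕ) : Pn k N m →ₐ[k] Pn k N n :=
  MvPolynomial.aeval fun p => ∑ t : Fin n, MvPolynomial.X (t, p.2)

/-- The operator `∂^{I_1} ⊗ ⋯ ⊗ ∂^{I_m}` on `B^{⊗m}`. -/
def derivOp (m : ℕ) (Is : Fin m → List (Fin N)) : Pn k N m →ₗ[k] Pn k N m :=
  ((List.finRange m).flatMap fun s => (Is s).map fun i => ((s, i) : Fin m × Fin N)).foldr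
    (fun p g => (MvPolynomial.pderiv p).toLinearMap.comp g) LinearMap.id

/-- The prefactor `x^{J_1} ⊗ ⋯ ⊗ x^{J_n} ∈ B^{⊗n}`. -/
def xMon (n : ℕ) (Js : Fin n → List (Fin N)) : Pn k N n :=
  ∏ t : Fin n, ((Js t).map fun i => (MvPolynomial.X (t, i) : Pn k N n)).prod

/-- The basic polydifferential operator `Γ^{J_1…J_n}_{I_1…I_m} : B^{⊗m} → B^{⊗n}`,
`f₁⊗…⊗f_m ↦ (x^{J_1}⊗…⊗x^{J_n}) ⋅ Δ^{n-1}(∂^{I_1}f_1) ⋯ Δ^{n-1}(∂^{I_m}f_m)`. -/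
def Γop (m n : ℕ) (Is : Fin m → List (Fin N)) (Js : Fin n → List (Fin N)) :
    Pn k N m →ₗ[k] Pn k N n :=
  (LinearMap.mulLeft k (xMon k N n Js)) ∘ₗ (spread k N m n).toLinearMap ∘ₗ derivOp k N m Is

/-- `Hom_poly(B^{⊗m}, B^{⊗n})`: the linear span of the basic polydifferential operators. -/
def polyHom (m n : ℕ) : Submodule k (Pn k N m →ₗ[k] Pn k N n) :=
  Submodule.span k {g | ∃ Is Js, g = Γop k N m n Is Js}

/-- Exponents of the slot-0 part of a monomial of `B^{⊗(m+1)}`. -/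
def frontExp (m : ℕ) (μ : (Fin (m + 1) × Fin N) →₀ ℕ) : Fin N →₀ ℕ :=
  Finsupp.comapDomain (fun i => ((0 : Fin (m + 1)), i)) μ
    (fun a _ b _ h => by simpa using h)

/-- Exponents of the slots `1,…,m` part of a monomial of `B^{⊗(m+1)}`. -/
def restExp (m : ℕ) (μ : (Fin (m + 1) × Fin N) →₀ ℕ) : (Fin m × Fin N) →₀ ℕ :=
  Finsupp.comapDomain (fun p : Fin m × Fin N => (p.1.succ, p.2)) μ
    (fun a _ b _ h => by
      rcases a with ⟨a1, a2⟩; rcases b with ⟨b1, b2⟩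
      simp only [Prod.mk.injEq] at h ⊢
      exact ⟨Fin.succ_inj.mp h.1, h.2⟩)

/-- Exponents of the last-slot part of a monomial of `B^{⊗(m+1)}`. -/
def lastExp (m : ℕ) (μ : (Fin (m + 1) × Fin N) →₀ ℕ) : Fin N →₀ ℕ :=
  Finsupp.comapDomain (fun i => ((Fin.last m : Fin (m + 1)), i)) μ
    (fun a _ b _ h => by simpa using h)

/-- Exponents of the slots `0,…,m-1` part of a monomial of `B^{⊗(m+1)}`. -/
def initExp (m : ℕ) (μ : (Fin (m + 1) × Fin N) →₀ ℕ) : (Fin m × Fin N) →₀ ℕ :=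
  Finsupp.comapDomain (fun p : Fin m × Fin N => (p.1.castSucc, p.2)) μ
    (fun a _ b _ h => by
      rcases a with ⟨a1, a2⟩; rcases b with ⟨b1, b2⟩
      simp only [Prod.mk.injEq] at h ⊢
      exact ⟨Fin.castSucc_inj.mp h.1, h.2⟩)

/-- The term `v₀ ⊗ v₁ ⊗ … ⊗ v_m ↦ Δ^{n-1}(v₀) ⋅ f(v₁ ⊗ … ⊗ v_m)` of the
Gerstenhaber–Schack differential `d₁`. -/
def termA (m n : ℕ) (f : Pn k N m →ₗ[k] Pn k N n) : Pn k N (m + 1) →ₗ[k] Pn k N n :=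
  (MvPolynomial.basisMonomials (Fin (m + 1) × Fin N) k).constr k fun μ =>
    (Δiter k N n) (MvPolynomial.monomial (frontExp N m μ) 1) *
      f (MvPolynomial.monomial (restExp N m μ) 1)

/-- The term `v₀ ⊗ … ⊗ v_m ↦ f(v₀ ⊗ … ⊗ v_{m-1}) ⋅ Δ^{n-1}(v_m)`. -/
def termC (m n : ℕ) (f : Pn k N m →ₗ[k] Pn k N n) : Pn k N (m + 1) →ₗ[k] Pn k N n :=
  (MvPolynomial.basisMonomials (Fin (m + 1) × Fin N) k).constr k fun μ =>
    f (MvPolynomial.monomial (initExp N m μ) 1) *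
      (Δiter k N n) (MvPolynomial.monomial (lastExp N m μ) 1)

/-- The Gerstenhaber–Schack differential `d₁` (Hochschild differential of the algebra `B`
with values in the `B`-bimodule `B^{⊗n}`). -/
def d1 (m n : ℕ) (f : Pn k N m →ₗ[k] Pn k N n) : Pn k N (m + 1) →ₗ[k] Pn k N n :=
  termA k N m n f
    + ∑ i : Fin m, ((-1 : k) ^ ((i : ℕ) + 1)) •
        (f ∘ₗ (MvPolynomial.rename (Prod.map i.predAbove id)).toLinearMap)
    + ((-1 : k) ^ (m + 1)) • termC k N m n f

/-- The left `B`-comodule structure `λ : B^{⊗m} → B ⊗ B^{⊗m}` (the extra `B`-factor is slot `0`). -/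
def lam (m : ℕ) : Pn k N m →ₐ[k] Pn k N (m + 1) :=
  MvPolynomial.aeval fun p =>
    MvPolynomial.X ((0 : Fin (m + 1)), p.2) + MvPolynomial.X (p.1.succ, p.2)

/-- The right `B`-comodule structure `ρ : B^{⊗m} → B^{⊗m} ⊗ B` (the extra `B`-factor is the last slot). -/
def rhoC (m : ℕ) : Pn k N m →ₐ[k] Pn k N (m + 1) :=
  MvPolynomial.aeval fun p =>
    MvPolynomial.X (p.1.castSucc, p.2) + MvPolynomial.X ((Fin.last m : Fin (m + 1)), p.2)

/-- The map `id_B ⊗ f : B ⊗ B^{⊗m} → B ⊗ B^{⊗n}` (extra factors in slot `0`). -/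
def lextend (m n : ℕ) (f : Pn k N m →ₗ[k] Pn k N n) :
    Pn k N (m + 1) →ₗ[k] Pn k N (n + 1) :=
  (MvPolynomial.basisMonomials (Fin (m + 1) × Fin N) k).constr k fun μ =>
    (MvPolynomial.monomial (Finsupp.mapDomain (fun i => ((0 : Fin (n + 1)), i)) (frontExp N m μ))
        (1 : k)) *
      (MvPolynomial.rename (Prod.map Fin.succ (id : Fin N → Fin N)))
        (f (MvPolynomial.monomial (restExp N m μ) 1))

/-- The map `f ⊗ id_B : B^{⊗m} ⊗ B → B^{⊗n} ⊗ B` (extra factors in the last slot). -/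
def rextend (m n : ℕ) (f : Pn k N m →ₗ[k] Pn k N n) :
    Pn k N (m + 1) →ₗ[k] Pn k N (n + 1) :=
  (MvPolynomial.basisMonomials (Fin (m + 1) × Fin N) k).constr k fun μ =>
    (MvPolynomial.rename (Prod.map Fin.castSucc (id : Fin N → Fin N)))
        (f (MvPolynomial.monomial (initExp N m μ) 1)) *
      (MvPolynomial.monomial
        (Finsupp.mapDomain (fun i => ((Fin.last n : Fin (n + 1)), i)) (lastExp N m μ)) (1 : k))

/-- The map `id^{⊗i} ⊗ Δ ⊗ id^{⊗(n-1-i)} : B^{⊗n} → B^{⊗(n+1)}` splitting slot `i`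
into slots `i, i+1`. -/
def coface (n : ℕ) (i : Fin n) : Pn k N n →ₐ[k] Pn k N (n + 1) :=
  MvPolynomial.aeval fun p =>
    if p.1 = i then
      MvPolynomial.X ((i.castSucc : Fin (n + 1)), p.2) + MvPolynomial.X (i.succ, p.2)
    else MvPolynomial.X (i.castSucc.succAbove p.1, p.2)

/-- The Gerstenhaber–Schack differential `d₂` (dual co-Hochschild differential of the
coalgebra `B` with values in the `B`-bicomodule `B^{⊗m}`). -/
def d2 (m n : ℕ) (f : Pn k N m →ₗ[k] Pn k N n) : Pn k N m →ₗ[k] Pn k N (n + 1) :=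
  (lextend k N m n f) ∘ₗ (lam k N m).toLinearMap
    + ∑ i : Fin n, ((-1 : k) ^ ((i : ℕ) + 1)) • ((coface k N n i).toLinearMap ∘ₗ f)
    + ((-1 : k) ^ (n + 1)) • ((rextend k N m n f) ∘ₗ (rhoC k N m).toLinearMap)

/-- The vector space `W` with its standard basis `x¹,…,x^N`. -/
abbrev W : Type := Fin N → k

/-- Linear embedding of `W` into slot `t` of `B^{⊗n}`: `x^j ↦ x_{(t,j)}`. -/
def slotEmb (n : ℕ) (t : Fin n) : W k N →ₗ[k] Pn k N n :=
  (Pi.basisFun k (Fin N)).constr k fun j => MvPolynomial.X (t, j)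

/-- The multilinear map `(w₁,…,w_n) ↦ (w₁ ⊗ … ⊗ w_n)` placing the `t`-th vector into slot `t`. -/
def placeMulti (n : ℕ) : MultilinearMap k (fun _ : Fin n => W k N) (Pn k N n) :=
  (MultilinearMap.mkPiAlgebra k (Fin n) (Pn k N n)).compLinearMap fun t => slotEmb k N n t

/-- The canonical (antisymmetrization) inclusion `Λ^n W → W^{⊗n} ⊂ B^{⊗n}`,
`w₁∧…∧w_n ↦ Σ_σ sgn(σ) w_{σ(1)} ⊗ … ⊗ w_{σ(n)}`. -/
def altPlace (n : ℕ) : (⋀[k]^n (W k N)) →ₗ[k] Pn k N n :=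
  (ExteriorAlgebra.liftAlternating
      (Function.update (fun i => (0 : (W k N) [⋀^Fin i]→ₗ[k] Pn k N n)) n
        (MultilinearMap.alternatization (placeMulti k N n)))) ∘ₗ
    (⋀[k]^n (W k N)).subtype

/-- The wedge `x^{a₁} ∧ … ∧ x^{a_m}` of standard basis vectors, as an element of `Λ^m W`. -/
def basisWedge (m : ℕ) (a : Fin m → Fin N) : (⋀[k]^m (W k N)) :=
  ⟨ExteriorAlgebra.ιMulti k m fun s => Pi.single (a s) (1 : k),
    ExteriorAlgebra.ιMulti_range k m (Set.mem_range_self _)⟩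

/-- The first-order polydifferential operator `F₁(f) ∈ Hom_poly(B^{⊗m}, B^{⊗n})` associated
to `f ∈ Hom_k(Λ^m W, Λ^n W)`:
`F₁(f)(g₁⊗…⊗g_m) = Σ_{a,b} f^{b₁…b_n}_{a₁…a_m} (x^{b₁}⊗…⊗x^{b_n}) ⋅ Δ^{n-1}(∂g₁/∂x^{a₁}) ⋯ Δ^{n-1}(∂g_m/∂x^{a_m})`. -/
def F1 (m n : ℕ) (f : (⋀[k]^m (W k N)) →ₗ[k] (⋀[k]^n (W k N))) :
    Pn k N m →ₗ[k] Pn k N n :=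
  ∑ a : Fin m → Fin N,
    (LinearMap.mulLeft k (altPlace k N n (f (basisWedge k N m a)))) ∘ₗ
      (spread k N m n).toLinearMap ∘ₗ derivOp k N m fun s => [a s]

section Cosimplicial

variable {k N}

set_option linter.unusedSectionVars false

lemma pderiv_algHom {σ τ : Type} [Fintype σ] (φ : MvPolynomial σ k →ₐ[k] MvPolynomial τ k)
    (p : τ) (f : MvPolynomial σ k) :
    pderiv p (φ f) = ∑ j, pderiv p (φ (X j)) * φ (pderiv j f) := by
  classical
  induction f using MvPolynomial.induction_on with
  | C a => simp [← MvPolynomial.algebraMap_eq]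
  | add f g hf hg => simp [hf, hg, mul_add, Finset.sum_add_distrib]
  | mul_X f i hf =>
    simp only [map_mul, pderiv_mul, hf, pderiv_X, map_add, mul_add, Finset.sum_add_distrib,
      Finset.sum_mul]
    congr 1
    · exact Finset.sum_congr rfl fun j _ => by ring
    · rw [Finset.sum_eq_single i]
      · simp [mul_comm]
      · intro j _ hj
        simp [Pi.single_eq_of_ne (M := fun _ => MvPolynomial σ k) hj.symm]
      · simp

lemma pderiv_algHom_of_eq {σ τ : Type} [Fintype σ] [DecidableEq σ]
    (φ : MvPolynomial σ k →ₐ[k] MvPolynomial τ k) (p : τ) (q : σ)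
    (h : ∀ j, pderiv p (φ (X j)) = if j = q then 1 else 0) (f : MvPolynomial σ k) :
    pderiv p (φ f) = φ (pderiv q f) := by
  rw [pderiv_algHom]
  simp [h]

lemma pderiv_pderiv_comm {σ : Type} (p q : σ) (f : MvPolynomial σ k) :
    pderiv p (pderiv q f) = pderiv q (pderiv p f) := by
  classical
  induction f using MvPolynomial.induction_on with
  | C a => simp
  | add f g hf hg => simp [hf, hg]
  | mul_X f i hf =>
    have h (a b : σ) : pderiv a (pderiv b (X i : MvPolynomial σ k)) = 0 := by
      rw [pderiv_X, Pi.single_apply]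
      split_ifs <;> simp
    simp only [pderiv_mul, map_add, hf, h]
    ring

variable (k N) in
/-- The coface maps of the cosimplicial algebra `n ↦ B^{⊗n}` with the last factor serving as
coefficients. -/
def face (n : ℕ) : Fin (n + 1) → (Pn k N n →ₐ[k] Pn k N (n + 1)) :=
  Fin.cons (MvPolynomial.rename (Prod.map Fin.succ id)) (coface k N n)

variable (k N) in
/-- The alternating sum of the maps `face`. -/
def del (n : ℕ) : Pn k N n →ₗ[k] Pn k N (n + 1) :=
  ∑ i : Fin (n + 1), (-1 : k) ^ (i : ℕ) • (face k N n i).toLinearMap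

variable (k N) in
/-- The inclusion `B^{⊗n} → B^{⊗(n+1)}` into the first `n` factors. -/
def incl (n : ℕ) : Pn k N n →ₐ[k] Pn k N (n + 1) :=
  MvPolynomial.rename (Prod.map Fin.castSucc id)

variable (k N) in
/-- The cobar differential of `B` with trivial coefficients. -/
def cobar (n : ℕ) : Pn k N n →ₗ[k] Pn k N (n + 1) :=
  del k N n + (-1 : k) ^ (n + 1) • (incl k N n).toLinearMap

lemma coface_X (n : ℕ) (i s : Fin n) (a : Fin N) :
    coface k N n i (X (s, a)) = ∑ r, if i.predAbove r = s then X (r, a) else 0 := by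
  have key (r : Fin (n + 1)) : i.predAbove r = s ↔
      if s = i then r = i.castSucc ∨ r = i.succ else r = i.castSucc.succAbove s := by
    simp only [Fin.predAbove, Fin.succAbove, Fin.ext_iff, Fin.lt_def, apply_ite Fin.val,
      apply_dite Fin.val, Fin.val_pred, Fin.coe_castPred, Fin.val_castSucc, Fin.val_succ]
    split_ifs <;> omega
  have hne : i.castSucc ≠ i.succ := Fin.castSucc_lt_succ.ne
  simp only [coface, aeval_X, key]
  split_ifs with h
  · rw [← Finset.sum_filter, Finset.filter_or, Finset.sum_union]
    · simp [Finset.filter_eq']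
    · simp [Finset.filter_eq', hne]
  · simp

variable (k N) in
/-- Passage to the coordinates in which the coface maps forget a coordinate. -/
def tailSum (n : ℕ) : Pn k N n →ₐ[k] Pn k N n :=
  MvPolynomial.aeval fun p => ∑ r, if p.1 ≤ r then MvPolynomial.X (r, p.2) else 0

lemma face_comp_tailSum (n : ℕ) (i : Fin (n + 1)) :
    (face k N n i).comp (tailSum k N n) =
      (tailSum k N (n + 1)).comp (MvPolynomial.rename (Prod.map i.succAbove id)) := by
  ext1 ⟨s, a⟩
  simp only [tailSum, AlgHom.comp_apply, aeval_X, rename_X, Prod.map, id, map_sum, apply_ite,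
    map_zero]
  induction i using Fin.cases with
  | zero => simp [face, Fin.sum_univ_succ]
  | succ j =>
    simp only [face, Fin.cons_succ, coface_X]
    have key (r : Fin (n + 1)) : j.succ.succAbove s ≤ r ↔ s ≤ j.predAbove r := by
      simp only [Fin.predAbove, Fin.succAbove, Fin.le_def, Fin.lt_def, apply_ite Fin.val,
        apply_dite Fin.val, Fin.val_pred, Fin.coe_castPred, Fin.val_castSucc, Fin.val_succ]
      split_ifs <;> omega
    simp only [key]
    have (x : Fin n) : (if s ≤ x then ∑ r, if j.predAbove r = x then (X (r, a) : Pn k N (n + 1))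
        else 0 else 0) = ∑ r, if s ≤ x then (if j.predAbove r = x then X (r, a) else 0) else 0 := by
      split_ifs <;> simp
    simp only [this]
    rw [Finset.sum_comm]
    refine Finset.sum_congr rfl fun r _ => ?_
    rw [Finset.sum_eq_single (j.predAbove r)]
    · simp
    · intro b _ hb
      simp [hb.symm]
    · simp

lemma tailSum_surjective (n : ℕ) : Function.Surjective (tailSum k N n) := by
  rw [← AlgHom.range_eq_top, eq_top_iff, ← MvPolynomial.adjoin_range_X, Algebra.adjoin_le_iff]
  have hmem (s : Fin n) (a : Fin N) :
      ∑ r, (if s ≤ r then (X (r, a) : Pn k N n) else 0) ∈ (tailSum k N n).range :=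
    ⟨X (s, a), by simp [tailSum]⟩
  rintro _ ⟨⟨s, a⟩, rfl⟩
  by_cases hs : (s : ℕ) + 1 < n
  · have := sub_mem (hmem s a) (hmem ⟨s + 1, hs⟩ a)
    rw [← Finset.sum_sub_distrib, Finset.sum_eq_single s] at this
    · simpa [Fin.le_def] using this
    · intro r _ hr
      have : s ≤ r ↔ (⟨s + 1, hs⟩ : Fin n) ≤ r := by
        simp only [Fin.le_def, ne_eq, Fin.ext_iff] at *; omega
      simp [this]
    · simp
  · have := hmem s a
    rw [Finset.sum_eq_single s] at this
    · simpa using this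
    · intro r _ hr
      have : ¬ s ≤ r := by simp only [Fin.le_def, ne_eq, Fin.ext_iff] at *; omega
      simp [this]
    · simp

variable (k N) in
/-- The differential `del` in the coordinates provided by `tailSum`. -/
def homDel (n : ℕ) : Pn k N n →ₗ[k] Pn k N (n + 1) :=
  ∑ i : Fin (n + 1), (-1 : k) ^ (i : ℕ) •
    (MvPolynomial.rename (R := k) (Prod.map i.succAbove (id : Fin N → Fin N))).toLinearMap

lemma homDel_homDel (n : ℕ) (f : Pn k N n) : homDel k N (n + 1) (homDel k N n f) = 0 := by
  simp only [homDel, LinearMap.sum_apply, LinearMap.smul_apply, AlgHom.toLinearMap_apply, map_sum,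
    map_smul, Finset.smul_sum, smul_smul, rename_rename, ← pow_add]
  rw [Finset.sum_comm, ← Finset.sum_product']
  refine Finset.sum_involution (fun p _ => (p.1.succAbove p.2, p.2.predAbove p.1)) ?_ ?_ ?_ ?_
  · rintro ⟨i, j⟩ -
    have h1 : (Prod.map (i.succAbove j).succAbove id ∘ Prod.map (j.predAbove i).succAbove id :
        Fin n × Fin N → _) = Prod.map i.succAbove id ∘ Prod.map j.succAbove id := by
      funext ⟨s, a⟩
      simp [Fin.succAbove_succAbove_succAbove_predAbove]
    have h2 := Fin.neg_one_pow_succAbove_add_predAbove (R := k) i j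
    rw [add_comm, add_comm (i : ℕ)] at h2
    simp [h1, h2]
  · rintro ⟨i, j⟩ - _ h
    exact Fin.succAbove_ne _ _ (congrArg Prod.fst h)
  · simp
  · rintro ⟨i, j⟩ -
    simp [Fin.succAbove_succAbove_predAbove, Fin.predAbove_predAbove_succAbove]

lemma del_tailSum (n : ℕ) (f : Pn k N n) :
    del k N n (tailSum k N n f) = tailSum k N (n + 1) (homDel k N n f) := by
  have h (i : Fin (n + 1)) := DFunLike.congr_fun (face_comp_tailSum (k := k) (N := N) n i) f
  simp only [AlgHom.comp_apply] at h
  simp [del, homDel, h]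

lemma del_del (n : ℕ) (f : Pn k N n) : del k N (n + 1) (del k N n f) = 0 := by
  obtain ⟨g, rfl⟩ := tailSum_surjective n f
  rw [del_tailSum, del_tailSum, homDel_homDel, map_zero]

end Cosimplicial

section Cobar

variable {k N}

set_option linter.unusedSectionVars false

lemma cobar_apply (n : ℕ) (q : Pn k N n) :
    cobar k N n q = MvPolynomial.rename (Prod.map Fin.succ id) q +
      ∑ i : Fin n, (-1 : k) ^ ((i : ℕ) + 1) • coface k N n i q +
      (-1 : k) ^ (n + 1) • MvPolynomial.rename (Prod.map Fin.castSucc id) q := by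
  simp [cobar, del, incl, face, Fin.sum_univ_succ]

lemma face_incl_castSucc (n : ℕ) (i : Fin (n + 1)) :
    (face k N (n + 1) i.castSucc).comp (incl k N n) = (incl k N (n + 1)).comp (face k N n i) := by
  ext1 ⟨s, a⟩
  induction i using Fin.cases with
  | zero => simp [face, incl]
  | succ j =>
    have key (r : Fin (n + 1)) : j.castSucc.predAbove r.castSucc = s.castSucc ↔
        j.predAbove r = s := by
      rw [Fin.castSucc_predAbove_castSucc, Fin.castSucc_inj]
    have key' : j.castSucc.predAbove (Fin.last (n + 1)) ≠ s.castSucc := by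
      rw [Fin.predAbove_right_last]; exact (Fin.castSucc_lt_last s).ne'
    simp only [face, ← Fin.succ_castSucc, Fin.cons_succ, incl, AlgHom.comp_apply, rename_X,
      Prod.map, id, coface_X, Fin.sum_univ_castSucc (n := n + 1), key, key', if_false, add_zero,
      map_sum, apply_ite, map_zero]

lemma face_incl_last (n : ℕ) :
    (face k N (n + 1) (Fin.last _)).comp (incl k N n) = (incl k N (n + 1)).comp (incl k N n) := by
  ext1 ⟨s, a⟩
  have h : s.castSucc ≠ Fin.last n := (Fin.castSucc_lt_last s).ne
  rw [← Fin.succ_last]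
  simp [face, incl, coface, h]

lemma del_incl (n : ℕ) (q : Pn k N n) :
    del k N (n + 1) (incl k N n q) = incl k N (n + 1) (cobar k N n q) := by
  have h1 (i : Fin (n + 1)) := DFunLike.congr_fun (face_incl_castSucc (k := k) (N := N) n i) q
  have h2 := DFunLike.congr_fun (face_incl_last (k := k) (N := N) n) q
  simp only [AlgHom.comp_apply] at h1 h2
  simp [cobar, del, Fin.sum_univ_castSucc (n := n + 1), h1, h2]

variable (k N) in
/-- The map `id ⊗ ε : B^{⊗(n+1)} → B^{⊗n}` applying the counit to the last factor. -/
def counitLast (n : ℕ) : Pn k N (n + 1) →ₐ[k] Pn k N n :=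
  MvPolynomial.aeval fun p =>
    Fin.lastCases (motive := fun _ => Pn k N n) 0 (fun s => MvPolynomial.X (s, p.2)) p.1

lemma counitLast_incl (n : ℕ) (q : Pn k N n) : counitLast k N n (incl k N n q) = q := by
  suffices (counitLast k N n).comp (incl k N n) = AlgHom.id k _ from DFunLike.congr_fun this q
  ext1 ⟨s, a⟩
  simp [counitLast, incl]

lemma counitLast_face_castSucc (n : ℕ) (i : Fin (n + 1)) :
    (counitLast k N (n + 1)).comp (face k N (n + 1) i.castSucc) =
      (face k N n i).comp (counitLast k N n) := by
  ext1 ⟨s, a⟩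
  induction i using Fin.cases with
  | zero =>
    induction s using Fin.lastCases with
    | last => simp [face, counitLast]
    | cast s =>
      have : s.castSucc.succ = s.succ.castSucc := rfl
      simp only [face, Fin.castSucc_zero, Fin.cons_zero, counitLast, AlgHom.comp_apply, rename_X,
        Prod.map, id, aeval_X, this, Fin.lastCases_castSucc]
  | succ j =>
    have key' : j.castSucc.predAbove (Fin.last (n + 1)) = Fin.last n := Fin.predAbove_right_last
    simp only [face, Fin.cons_succ, ← Fin.succ_castSucc, AlgHom.comp_apply, coface_X,
      Fin.sum_univ_castSucc (n := n + 1), key', Fin.castSucc_predAbove_castSucc]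
    induction s using Fin.lastCases with
    | last =>
      have (r : Fin (n + 1)) : (j.predAbove r).castSucc ≠ Fin.last n :=
        (Fin.castSucc_lt_last _).ne
      simp [counitLast, this]
    | cast s =>
      have : Fin.last n ≠ s.castSucc := (Fin.castSucc_lt_last _).ne'
      simp [counitLast, this, coface_X, apply_ite]

lemma counitLast_face_last (n : ℕ) :
    (counitLast k N (n + 1)).comp (face k N (n + 1) (Fin.last _)) = AlgHom.id k _ := by
  ext1 ⟨s, a⟩
  rw [← Fin.succ_last]
  induction s using Fin.lastCases with
  | last => simp [face, counitLast, coface]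
  | cast s =>
    have h : s.castSucc ≠ Fin.last n := (Fin.castSucc_lt_last s).ne
    simp [face, counitLast, coface, h]

lemma counitLast_del (n : ℕ) (f : Pn k N (n + 1)) :
    counitLast k N (n + 1) (del k N (n + 1) f) =
      del k N n (counitLast k N n f) + (-1 : k) ^ (n + 1) • f := by
  have h1 (i : Fin (n + 1)) :=
    DFunLike.congr_fun (counitLast_face_castSucc (k := k) (N := N) n i) f
  have h2 := DFunLike.congr_fun (counitLast_face_last (k := k) (N := N) n) f
  simp only [AlgHom.comp_apply] at h1 h2
  simp [del, Fin.sum_univ_castSucc (n := n + 1), h1, h2]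

lemma exists_del_eq_of_del_eq_zero (n : ℕ) {f : Pn k N (n + 1)} (hf : del k N (n + 1) f = 0) :
    ∃ g : Pn k N n, del k N n g = f := by
  have h := counitLast_del n f
  rw [hf, map_zero] at h
  refine ⟨(-1 : k) ^ n • counitLast k N n f, ?_⟩
  rw [map_smul, eq_neg_of_add_eq_zero_left h.symm, ← neg_smul, smul_smul, pow_succ, mul_neg_one,
    neg_neg, ← pow_add, Even.neg_one_pow ⟨n, rfl⟩, one_smul]

lemma pderiv_face (n : ℕ) (i : Fin (n + 2)) (j : Fin N) (f : Pn k N (n + 1)) :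
    pderiv (Fin.last (n + 1), j) (face k N (n + 1) i f) =
      face k N (n + 1) i (pderiv (Fin.last n, j) f) := by
  refine pderiv_algHom_of_eq _ _ _ ?_ f
  rintro ⟨s, a⟩
  induction i using Fin.cases with
  | zero => simp [face, Pi.single_apply, ← Fin.succ_last, -Fin.succ_eq_last_succ]
  | succ i =>
    have (r : Fin (n + 2)) (hr : r ≠ Fin.last (n + 1)) : (if i.predAbove r = s then
        pderiv (Fin.last (n + 1), j) (X (r, a) : Pn k N (n + 2)) else 0) = 0 := by
      simp [pderiv_X, hr]
    simp only [face, Fin.cons_succ, coface_X, map_sum, apply_ite, map_zero]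
    rw [Finset.sum_eq_single (Fin.last (n + 1)) (fun r _ hr => this r hr) (by simp)]
    simp only [Fin.predAbove_right_last, pderiv_X, Pi.single_apply, Prod.mk.injEq, true_and,
      eq_comm (a := Fin.last n), ite_and]
    split_ifs <;> rfl

lemma pderiv_del (n : ℕ) (j : Fin N) (f : Pn k N (n + 1)) :
    pderiv (Fin.last (n + 1), j) (del k N (n + 1) f) =
      del k N (n + 1) (pderiv (Fin.last n, j) f) := by
  simp [del, pderiv_face]

lemma pderiv_incl (n : ℕ) (j : Fin N) (q : Pn k N n) :
    pderiv (Fin.last n, j) (incl k N n q) = 0 := by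
  rw [pderiv_algHom]
  refine Finset.sum_eq_zero fun p _ => ?_
  have h : p.1.castSucc ≠ Fin.last n := (Fin.castSucc_lt_last _).ne
  have h' : Prod.map Fin.castSucc id p ≠ (Fin.last n, j) := fun e => h (congrArg Prod.fst e)
  simp [incl, h']

lemma incl_counitLast_of_pderiv_eq_zero (n : ℕ) (f : Pn k N (n + 1))
    (hf : ∀ j, pderiv (Fin.last n, j) f = 0) : incl k N n (counitLast k N n f) = f := by
  obtain ⟨g, rfl⟩ := exists_rename_eq_of_vars_subset_range f (Prod.map Fin.castSucc id)
    (Function.Injective.prodMap (Fin.castSucc_injective n) Function.injective_id) (by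
      rintro ⟨s, a⟩ hs
      induction s using Fin.lastCases with
      | cast s => exact ⟨(s, a), rfl⟩
      | last =>
        exfalso
        obtain ⟨μ, hμ, hs⟩ := (mem_vars_iff_mem_support _).mp hs
        have hle : Finsupp.single (Fin.last n, a) 1 ≤ μ := by
          simpa [Nat.one_le_iff_ne_zero] using hs
        have := congrArg (coeff (μ - Finsupp.single (Fin.last n, a) 1)) (hf a)
        rw [coeff_pderiv, tsub_add_cancel_of_le hle, coeff_zero, mul_eq_zero] at this
        rcases this with h | h
        · exact (mem_support_iff.mp hμ) h
        · exact Nat.cast_add_one_ne_zero _ h)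
  exact congrArg (incl k N n) (counitLast_incl n g)

lemma exists_antiderivative {σ : Type} (p : σ) : ∃ I : MvPolynomial σ k →ₗ[k] MvPolynomial σ k,
    (∀ f, pderiv p (I f) = f) ∧ ∀ q, q ≠ p → ∀ f, pderiv q (I f) = I (pderiv q f) := by
  classical
  set I : MvPolynomial σ k →ₗ[k] MvPolynomial σ k := (basisMonomials σ k).constr k fun μ =>
    monomial (μ + Finsupp.single p 1) ((μ p + 1 : k)⁻¹) with hI
  have hIm (μ : σ →₀ ℕ) (c : k) :
      I (monomial μ c) = monomial (μ + Finsupp.single p 1) (c * (μ p + 1 : k)⁻¹) := by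
    have := (basisMonomials σ k).constr_basis k (fun μ : σ →₀ ℕ =>
      (monomial (μ + Finsupp.single p 1) ((μ p + 1 : k)⁻¹) : MvPolynomial σ k)) μ
    rw [coe_basisMonomials] at this
    have hc : monomial μ c = c • (monomial μ (1 : k)) := by simp [smul_monomial]
    rw [hc, map_smul, this, smul_monomial, smul_eq_mul]
  refine ⟨I, fun f => ?_, fun q hq f => ?_⟩
  · induction f using MvPolynomial.induction_on' with
    | monomial μ c =>
      have : (μ p + 1 : k) ≠ 0 := Nat.cast_add_one_ne_zero _
      simp [hIm, this]
    | add f g hf hg => simp [hf, hg]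
  · induction f using MvPolynomial.induction_on' with
    | monomial μ c =>
      rw [hIm, pderiv_monomial, pderiv_monomial, hIm]
      by_cases h : μ q = 0
      · simp [h, Finsupp.single_eq_of_ne hq]
      · have hle : Finsupp.single q 1 ≤ μ := by simpa [Nat.one_le_iff_ne_zero] using h
        rw [tsub_add_eq_add_tsub hle]
        simp [Finsupp.single_eq_of_ne hq, Finsupp.single_eq_of_ne hq.symm, mul_right_comm]
    | add f g hf hg => simp [hf, hg]

end Cobar

section Cocycles

variable {k N}

set_option linter.unusedSectionVars false

variable (k N) in
/-- The multilinear monomial `x^{a₁} ⊗ ⋯ ⊗ x^{a_n}`. -/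
def linMon (n : ℕ) (a : Fin n → Fin N) : Pn k N n := ∏ s, X (s, a s)

lemma telescope {V : Type} [AddCommGroup V] [Module k V] (n : ℕ) (M : Fin (n + 1) → V) :
    M 0 + ∑ j : Fin n, (-1 : k) ^ ((j : ℕ) + 1) • (M j.castSucc + M j.succ) +
      (-1 : k) ^ (n + 1) • M (Fin.last n) = 0 := by
  induction n with
  | zero => simp
  | succ n ih =>
    have h := ih (fun j => M j.castSucc)
    rw [Fin.sum_univ_castSucc]
    simp only [Fin.val_castSucc, Fin.val_last, Fin.castSucc_zero, Fin.succ_last,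
      ← Fin.succ_castSucc] at h ⊢
    rw [← h, pow_succ (-1 : k) (n + 1)]
    module

variable (k N) in
/-- The multilinear monomial `x^{a₁} ⊗ ⋯ ⊗ x^{a_n}` with a factor `1` inserted at position `j`. -/
def gapMon (n : ℕ) (a : Fin n → Fin N) (j : Fin (n + 1)) : Pn k N (n + 1) :=
  ∏ s, X (j.succAbove s, a s)

lemma coface_X_eq (n : ℕ) (j s : Fin n) (b : Fin N) :
    coface k N n j (X (s, b)) = if s = j then X (j.castSucc, b) + X (j.succ, b)
      else X (j.castSucc.succAbove s, b) := by
  simp [coface]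

lemma succ_succAbove_of_ne {n : ℕ} {j s : Fin n} (h : s ≠ j) :
    j.succ.succAbove s = j.castSucc.succAbove s := by
  simp only [Fin.succAbove, Fin.ext_iff, Fin.lt_def, ne_eq] at *
  split_ifs <;> simp at * <;> omega

lemma coface_linMon (n : ℕ) (a : Fin n → Fin N) (j : Fin n) :
    coface k N n j (linMon k N n a) = gapMon k N n a j.castSucc + gapMon k N n a j.succ := by
  classical
  have h1 : ∏ s ∈ Finset.univ.erase j, coface k N n j (X (s, a s)) =
      ∏ s ∈ Finset.univ.erase j, X (j.castSucc.succAbove s, a s) :=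
    Finset.prod_congr rfl fun s hs => by
      rw [coface_X_eq, if_neg (Finset.ne_of_mem_erase hs)]
  have h2 : ∏ s ∈ Finset.univ.erase j, (X (j.succ.succAbove s, a s) : Pn k N (n + 1)) =
      ∏ s ∈ Finset.univ.erase j, X (j.castSucc.succAbove s, a s) :=
    Finset.prod_congr rfl fun s hs => by
      rw [succ_succAbove_of_ne (Finset.ne_of_mem_erase hs)]
  rw [linMon, gapMon, gapMon, map_prod, ← Finset.mul_prod_erase _ _ (Finset.mem_univ j), h1,
    ← Finset.mul_prod_erase _ (fun s => X (j.castSucc.succAbove s, a s)) (Finset.mem_univ j),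
    ← Finset.mul_prod_erase _ (fun s => X (j.succ.succAbove s, a s)) (Finset.mem_univ j), h2,
    coface_X_eq, if_pos rfl, Fin.succAbove_castSucc_self, Fin.succAbove_succ_self]
  ring

lemma rename_succ_linMon (n : ℕ) (a : Fin n → Fin N) :
    rename (Prod.map Fin.succ id) (linMon k N n a) = gapMon k N n a 0 := by
  simp [linMon, gapMon]

lemma rename_castSucc_linMon (n : ℕ) (a : Fin n → Fin N) :
    rename (Prod.map Fin.castSucc id) (linMon k N n a) = gapMon k N n a (Fin.last n) := by
  simp [linMon, gapMon]

lemma cobar_linMon (n : ℕ) (a : Fin n → Fin N) : cobar k N n (linMon k N n a) = 0 := by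
  simp only [cobar_apply, coface_linMon, rename_succ_linMon, rename_castSucc_linMon]
  exact telescope n _

lemma gapMon_castSucc_mul_X (n : ℕ) (c : Fin (n + 1) → Fin N) (i : Fin n) :
    gapMon k N n (fun s => c (i.castSucc.succAbove s)) i.castSucc * X (i.castSucc, c i.castSucc) =
      linMon k N (n + 1) c := by
  rw [linMon, Fin.prod_univ_succAbove _ i.castSucc, mul_comm]
  rfl

lemma gapMon_succ_mul_X (n : ℕ) (c : Fin (n + 1) → Fin N) (i : Fin n) :
    gapMon k N n (fun s => c (i.castSucc.succAbove s)) i.succ * X (i.succ, c i.castSucc) =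
      linMon k N (n + 1) (c ∘ Equiv.swap i.castSucc i.succ) := by
  rw [linMon, Fin.prod_univ_succAbove _ i.succ, mul_comm]
  simp only [Function.comp_apply, Equiv.swap_apply_right, gapMon]
  congr 1
  refine Finset.prod_congr rfl fun s _ => ?_
  congr 3
  by_cases h : s = i
  · subst h
    rw [Fin.succAbove_castSucc_self, Fin.succAbove_succ_self, Equiv.swap_apply_left]
  · rw [← succ_succAbove_of_ne h, Equiv.swap_apply_of_ne_of_ne _ (Fin.succAbove_ne _ _)]
    rw [succ_succAbove_of_ne h]
    exact Fin.succAbove_ne _ _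

/-- Multilinear monomials differing by an adjacent transposition are cohomologous up to sign. -/
lemma linMon_add_linMon_swap_mem (n : ℕ) (c : Fin (n + 1) → Fin N) (i : Fin n) :
    linMon k N (n + 1) c + linMon k N (n + 1) (c ∘ Equiv.swap i.castSucc i.succ) ∈
      LinearMap.range (cobar k N n) := by
  set a : Fin n → Fin N := fun s => c (i.castSucc.succAbove s) with ha
  set b := c i.castSucc with hb
  set M : Fin (n + 1) → Pn k N (n + 1) :=
    fun j => gapMon k N n a j * X (j.succAbove i, b) with hM
  have hc (j : Fin n) : coface k N n j (linMon k N n a * X (i, b)) =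
      M j.castSucc + M j.succ + if j = i then linMon k N (n + 1) c +
        linMon k N (n + 1) (c ∘ Equiv.swap i.castSucc i.succ) else 0 := by
    rw [map_mul, coface_linMon, coface_X_eq, ← gapMon_castSucc_mul_X n c i,
      ← gapMon_succ_mul_X n c i]
    by_cases h : i = j
    · subst h
      simp only [hM, if_true, Fin.succAbove_castSucc_self, Fin.succAbove_succ_self]
      ring
    · rw [if_neg h, if_neg (Ne.symm h)]
      simp only [hM, succ_succAbove_of_ne h]
      ring
  have key : cobar k N n (linMon k N n a * X (i, b)) = (-1 : k) ^ ((i : ℕ) + 1) •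
      (linMon k N (n + 1) c + linMon k N (n + 1) (c ∘ Equiv.swap i.castSucc i.succ)) := by
    have h0 : rename (Prod.map Fin.succ id) (linMon k N n a * X (i, b)) = M 0 := by
      simp [hM, rename_succ_linMon]
    have h1 : rename (Prod.map Fin.castSucc id) (linMon k N n a * X (i, b)) =
        M (Fin.last n) := by
      simp [hM, rename_castSucc_linMon]
    rw [cobar_apply, h0, h1]
    simp only [hc, smul_add _ (_ + _) (ite _ _ _), Finset.sum_add_distrib]
    have ht := telescope (k := k) n M
    simp only [smul_ite, smul_zero, Finset.sum_ite_eq', Finset.mem_univ, if_true]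
    rw [← add_assoc, add_right_comm, ht, zero_add]
  refine ⟨(-1 : k) ^ ((i : ℕ) + 1) • (linMon k N n a * X (i, b)), ?_⟩
  rw [map_smul, key, smul_smul, ← pow_add, Even.neg_one_pow ⟨_, rfl⟩, one_smul]

variable (k N) in
/-- Elements of `B^{⊗(n+1)}` in which only the first `j` variables of the last factor occur. -/
def tailVars (j n : ℕ) : Submodule k (Pn k N (n + 1)) :=
  ⨅ (i : Fin N) (_ : j ≤ i), LinearMap.ker (pderiv (R := k) (Fin.last n, i)).toLinearMap

lemma mem_tailVars {j n : ℕ} {f : Pn k N (n + 1)} :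
    f ∈ tailVars k N j n ↔ ∀ i : Fin N, j ≤ i → pderiv (Fin.last n, i) f = 0 := by
  simp [tailVars, Submodule.mem_iInf]

variable (k N) in
/-- The span of the multilinear monomials in the first `n` factors of `B^{⊗(n+1)}`. -/
def linSpan (n : ℕ) : Submodule k (Pn k N (n + 1)) :=
  Submodule.span k (Set.range fun a => incl k N n (linMon k N n a))

lemma incl_linMon_mul_X (n : ℕ) (a : Fin n → Fin N) (j : Fin N) :
    incl k N n (linMon k N n a) * X (Fin.last n, j) =
      linMon k N (n + 1) (Fin.snoc (α := fun _ => Fin N) a j) := by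
  simp [linMon, incl, Fin.prod_univ_castSucc]

lemma del_incl_linMon_mul_X_mem (n : ℕ) (a : Fin n → Fin N) (j : Fin N) :
    del k N (n + 1) (incl k N n (linMon k N n a) * X (Fin.last n, j)) ∈ linSpan k N (n + 1) := by
  rw [incl_linMon_mul_X]
  have h := cobar_linMon (k := k) (n + 1) (Fin.snoc (α := fun _ => Fin N) a j)
  rw [cobar, LinearMap.add_apply] at h
  rw [eq_neg_of_add_eq_zero_left h]
  exact neg_mem (Submodule.smul_mem _ _ (Submodule.subset_span ⟨_, rfl⟩))

lemma linSpan_le_tailVars (j n : ℕ) : linSpan k N n ≤ tailVars k N j n := by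
  rw [linSpan, Submodule.span_le]
  rintro _ ⟨a, rfl⟩
  exact mem_tailVars.mpr fun i _ => pderiv_incl n i _

/-- Elements of `tailVars (j+1) n` whose `j`-th derivative in the last factor is a sum of a
multilinear element and a coboundary have a primitive with multilinear coboundary. -/
lemma exists_primitive_of_mem_linSpan (j : Fin N) (n : ℕ) {f : Pn k N (n + 1)}
    (hf : f ∈ linSpan k N n) : ∃ g ∈ tailVars k N (j + 1) n,
      pderiv (Fin.last n, j) g = f ∧ del k N (n + 1) g ∈ linSpan k N (n + 1) := by
  induction hf using Submodule.span_induction with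
  | mem f hf =>
    obtain ⟨a, rfl⟩ := hf
    refine ⟨incl k N n (linMon k N n a) * X (Fin.last n, j), mem_tailVars.mpr fun i hi => ?_, ?_,
      del_incl_linMon_mul_X_mem n a j⟩
    · have : j ≠ i := by rintro rfl; omega
      simp [pderiv_incl, this]
    · simp [pderiv_incl]
  | zero => exact ⟨0, zero_mem _, by simp, by simp⟩
  | add f f' _ _ hf hf' =>
    obtain ⟨g, h1, h2, h3⟩ := hf
    obtain ⟨g', h1', h2', h3'⟩ := hf'
    exact ⟨g + g', add_mem h1 h1', by rw [map_add, h2, h2'], by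
      rw [map_add]; exact add_mem h3 h3'⟩
  | smul c f _ hf =>
    obtain ⟨g, h1, h2, h3⟩ := hf
    exact ⟨c • g, Submodule.smul_mem _ _ h1, by rw [Derivation.map_smul, h2], by
      rw [map_smul]; exact Submodule.smul_mem _ _ h3⟩

lemma exists_tailVars_antiderivative (j : Fin N) (n : ℕ) {f : Pn k N (n + 1)}
    (hf : f ∈ tailVars k N (j + 1) n) :
    ∃ g ∈ tailVars k N (j + 1) n, pderiv (Fin.last n, j) g = f := by
  obtain ⟨I, h1, h2⟩ := exists_antiderivative (k := k) (Fin.last n, j)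
  refine ⟨I f, mem_tailVars.mpr fun i hi => ?_, h1 f⟩
  rw [h2, mem_tailVars.mp hf i hi, map_zero]
  intro h
  have : i = j := congrArg Prod.snd h
  subst this; omega

lemma linSpan_zero_of_del (f : Pn k N 0) : del k N 0 f ∈ linSpan k N 0 := by
  obtain ⟨c, rfl⟩ := C_surjective (Fin 0 × Fin N) f
  have : del k N 0 (C c) = c • incl k N 0 (linMon k N 0 Fin.elim0) := by
    simp [del, face, incl, linMon, smul_eq_C_mul]
  rw [this]
  exact Submodule.smul_mem _ _ (Submodule.subset_span ⟨_, rfl⟩)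

/-- Cocycles in the standard complex with coefficients in the polynomials in the first `j`
variables are cohomologous to multilinear ones. -/
lemma exists_linSpan_add_del (d : ℕ) : ∀ (n j : ℕ) (f : Pn k N (n + 2)), N ≤ j + d →
    f ∈ tailVars k N j (n + 1) → del k N (n + 2) f = 0 →
    ∃ l ∈ linSpan k N (n + 1), ∃ g ∈ tailVars k N j n, f = l + del k N (n + 1) g := by
  induction d with
  | zero =>
    intro n j f hj _ hd
    obtain ⟨g, rfl⟩ := exists_del_eq_of_del_eq_zero (n + 1) hd
    refine ⟨0, zero_mem _, g, mem_tailVars.mpr fun i hi => ?_, by simp⟩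
    have := i.2; omega
  | succ d ih =>
    intro n j f hj hf hd
    have mono : ∀ m, tailVars k N j m ≤ tailVars k N (j + 1) m := fun m x hx =>
      mem_tailVars.mpr fun i hi => mem_tailVars.mp hx i (by omega)
    obtain ⟨l, hl, g, hg, hfg⟩ := ih n (j + 1) f (by omega) (mono _ hf) hd
    by_cases hjN : N ≤ j
    · refine ⟨l, hl, g, mem_tailVars.mpr fun i hi => ?_, hfg⟩
      have := i.2; omega
    obtain ⟨i, rfl⟩ : ∃ i : Fin N, (i : ℕ) = j := ⟨⟨j, by omega⟩, rfl⟩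
    -- the derivative of `g` is a cocycle with coefficients in one more variable
    have hdg : del k N (n + 1) (pderiv (Fin.last n, i) g) = 0 := by
      have h := congrArg (pderiv (Fin.last (n + 1), i)) hfg
      rwa [map_add, mem_tailVars.mp hf i le_rfl, pderiv_del,
        mem_tailVars.mp (linSpan_le_tailVars 0 _ hl) i (Nat.zero_le _), zero_add, eq_comm] at h
    have hdg' : pderiv (Fin.last n, i) g ∈ tailVars k N (i + 1) n := mem_tailVars.mpr fun i' hi' => by
      rw [pderiv_pderiv_comm, mem_tailVars.mp hg i' hi', map_zero]
    obtain ⟨p, hp, hpd, hpl⟩ : ∃ p ∈ tailVars k N (i + 1) n,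
        pderiv (Fin.last n, i) p = pderiv (Fin.last n, i) g ∧
          del k N (n + 1) p ∈ linSpan k N (n + 1) := by
      cases n with
      | zero =>
        obtain ⟨c, hc⟩ := exists_del_eq_of_del_eq_zero 0 hdg
        rw [← hc]
        exact exists_primitive_of_mem_linSpan i 0 (linSpan_zero_of_del c)
      | succ n =>
        obtain ⟨l', hl', g', hg', h'⟩ := ih n (i + 1) _ (by omega) hdg' hdg
        obtain ⟨p, hp, hpd, hpl⟩ := exists_primitive_of_mem_linSpan i (n + 1) hl'
        obtain ⟨q, hq, hqd⟩ := exists_tailVars_antiderivative i n hg'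
        refine ⟨p + del k N (n + 1) q, add_mem hp (mem_tailVars.mpr fun i' hi' => ?_), ?_, ?_⟩
        · rw [pderiv_del, mem_tailVars.mp hq i' hi', map_zero]
        · rw [h', map_add, hpd, pderiv_del, hqd]
        · rwa [map_add, del_del, add_zero]
    refine ⟨l + del k N (n + 1) p, add_mem hl hpl, g - p, mem_tailVars.mpr fun i' hi' => ?_, ?_⟩
    · rw [map_sub]
      rcases (show (i : ℕ) = i' ∨ (i : ℕ) + 1 ≤ i' by omega) with h | h
      · obtain rfl := Fin.ext h
        rw [hpd, sub_self]
      · rw [mem_tailVars.mp hg i' h, mem_tailVars.mp hp i' h, sub_self]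
    · rw [hfg, map_sub]; abel

/-- Every cobar cocycle is cohomologous to a multilinear one. -/
lemma exists_linMon_add_cobar (n : ℕ) {q : Pn k N (n + 1)} (hq : cobar k N (n + 1) q = 0) :
    ∃ l ∈ Submodule.span k (Set.range (linMon k N (n + 1))), ∃ r, q = l + cobar k N n r := by
  obtain ⟨l, hl, g, hg, h⟩ := exists_linSpan_add_del N n 0 (incl k N (n + 1) q) (by omega)
    (mem_tailVars.mpr fun i _ => pderiv_incl _ i q) (by rw [del_incl, hq, map_zero])
  have hl' : ∃ l' ∈ Submodule.span k (Set.range (linMon k N (n + 1))), incl k N (n + 1) l' = l := by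
    have : linSpan k N (n + 1) =
        (Submodule.span k (Set.range (linMon k N (n + 1)))).map (incl k N (n + 1)).toLinearMap := by
      rw [Submodule.map_span, ← Set.range_comp]; rfl
    rw [this] at hl
    exact hl
  obtain ⟨l', hl', rfl⟩ := hl'
  refine ⟨l', hl', counitLast k N n g, ?_⟩
  have hg' := incl_counitLast_of_pderiv_eq_zero n g fun i => mem_tailVars.mp hg i (Nat.zero_le _)
  rw [← hg', del_incl, ← map_add] at h
  have := congrArg (counitLast k N (n + 1)) h
  simpa only [counitLast_incl] using this

end Cocycles

section Alternating

variable {k N}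

set_option linter.unusedSectionVars false

/-- The exponent of the multilinear monomial `x^{a₁} ⊗ ⋯ ⊗ x^{a_n}`. -/
def linExp {n : ℕ} (a : Fin n → Fin N) : (Fin n × Fin N) →₀ ℕ :=
  ∑ s, Finsupp.single (s, a s) 1

lemma linMon_eq_monomial (n : ℕ) (a : Fin n → Fin N) :
    linMon k N n a = monomial (linExp a) 1 := by
  rw [linExp, monomial_sum_one]; rfl

lemma linExp_apply {n : ℕ} (a : Fin n → Fin N) (s : Fin n) (j : Fin N) :
    linExp a (s, j) = if a s = j then 1 else 0 := by
  rw [linExp, Finsupp.finsetSum_apply, Finset.sum_eq_single s]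
  · simp [Finsupp.single_apply]
  · intro t _ ht
    simp [ht]
  · simp

lemma linExp_injective {n : ℕ} : Function.Injective (linExp (N := N) (n := n)) := by
  intro a b h
  funext s
  have := DFunLike.congr_fun h (s, b s)
  simpa [linExp_apply] using this

lemma mapDomain_linExp {n : ℕ} (a : Fin n → Fin N) (σ : Equiv.Perm (Fin n)) :
    Finsupp.mapDomain (Prod.map σ id) (linExp (a ∘ σ)) = linExp a := by
  simp only [linExp, Finsupp.mapDomain_finsetSum, Finsupp.mapDomain_single, Prod.map, id,
    Function.comp_apply]
  exact Equiv.sum_comp σ fun s => Finsupp.single (s, a s) 1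

lemma coeff_linMon (n : ℕ) (a b : Fin n → Fin N) :
    coeff (linExp a) (linMon k N n b) = if a = b then 1 else 0 := by
  classical
  simp [linMon_eq_monomial, coeff_monomial, linExp_injective.eq_iff, eq_comm]

lemma coe_basisWedge (n : ℕ) (a : Fin n → Fin N) : basisWedge k N n a =
    exteriorPower.ιMulti k n fun s => Pi.basisFun k (Fin N) (a s) := by
  ext1; simp [basisWedge]

lemma basisWedge_comp_perm (n : ℕ) (a : Fin n → Fin N) (σ : Equiv.Perm (Fin n)) :
    basisWedge k N n (a ∘ σ) = Equiv.Perm.sign σ • basisWedge k N n a := by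
  rw [coe_basisWedge, coe_basisWedge, ← AlternatingMap.map_perm]; rfl

lemma hom_ext_basisWedge {n : ℕ} {V : Type} [AddCommGroup V] [Module k V]
    {f g : (⋀[k]^n (W k N)) →ₗ[k] V}
    (h : ∀ a, f (basisWedge k N n a) = g (basisWedge k N n a)) : f = g := by
  refine exteriorPower.linearMap_ext (Module.Basis.ext_alternating (Pi.basisFun k (Fin N))
    fun v _ => ?_)
  simpa [coe_basisWedge] using h v

lemma altPlace_basisWedge (n : ℕ) (a : Fin n → Fin N) :
    altPlace k N n (basisWedge k N n a) =
      ∑ σ : Equiv.Perm (Fin n), Equiv.Perm.sign σ • linMon k N n (a ∘ σ) := by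
  simp only [altPlace, LinearMap.comp_apply, Submodule.subtype_apply, basisWedge,
    ExteriorAlgebra.liftAlternating_apply_ιMulti, Function.update_self,
    MultilinearMap.alternatization_apply]
  refine Finset.sum_congr rfl fun σ _ => ?_
  congr 1
  simp only [MultilinearMap.domDomCongr_apply, placeMulti, MultilinearMap.compLinearMap_apply,
    MultilinearMap.mkPiAlgebra_apply, linMon, slotEmb, Function.comp_apply]
  refine Finset.prod_congr rfl fun s _ => ?_
  rw [← Pi.basisFun_apply, Module.Basis.constr_basis]

variable (k N) in
/-- The projection `B^{⊗n} → Λ^n W` killing the monomials which are not multilinear. -/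
def toWedge (n : ℕ) : Pn k N n →ₗ[k] (⋀[k]^n (W k N)) :=
  (n.factorial : k)⁻¹ • ∑ a : Fin n → Fin N, (lcoeff k (linExp a)).smulRight (basisWedge k N n a)

lemma toWedge_apply (n : ℕ) (q : Pn k N n) : toWedge k N n q =
    (n.factorial : k)⁻¹ • ∑ a : Fin n → Fin N, coeff (linExp a) q • basisWedge k N n a := by
  simp [toWedge]

lemma toWedge_linMon (n : ℕ) (a : Fin n → Fin N) :
    toWedge k N n (linMon k N n a) = (n.factorial : k)⁻¹ • basisWedge k N n a := by
  simp [toWedge_apply, coeff_linMon]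

lemma sign_smul_sign_smul {V : Type} [AddCommGroup V] {n : ℕ} (σ : Equiv.Perm (Fin n)) (v : V) :
    Equiv.Perm.sign σ • Equiv.Perm.sign σ • v = v := by
  rw [smul_smul, Int.units_mul_self, one_smul]

lemma toWedge_altPlace (n : ℕ) (w : ⋀[k]^n (W k N)) :
    toWedge k N n (altPlace k N n w) = w := by
  suffices (toWedge k N n) ∘ₗ (altPlace k N n) = LinearMap.id from DFunLike.congr_fun this w
  refine hom_ext_basisWedge fun a => ?_
  have (σ : Equiv.Perm (Fin n)) :
      toWedge k N n (Equiv.Perm.sign σ • linMon k N n (a ∘ σ)) =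
        (n.factorial : k)⁻¹ • basisWedge k N n a := by
    have h : toWedge k N n (Equiv.Perm.sign σ • linMon k N n (a ∘ σ)) =
        Equiv.Perm.sign σ • toWedge k N n (linMon k N n (a ∘ σ)) := by
      simp only [Units.smul_def, map_zsmul]
    rw [h, toWedge_linMon, basisWedge_comp_perm, smul_comm, sign_smul_sign_smul]
  have hn : (n.factorial : k) ≠ 0 := by exact_mod_cast n.factorial_ne_zero
  rw [LinearMap.comp_apply, altPlace_basisWedge, map_sum, Finset.sum_congr rfl fun σ _ => this σ]
  simp [Fintype.card_perm, ← Nat.cast_smul_eq_nsmul k, smul_smul, hn]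

variable (k N) in
/-- The projection of `B^{⊗n}` onto the antisymmetric multilinear elements. -/
def altProj (n : ℕ) : Pn k N n →ₗ[k] Pn k N n := altPlace k N n ∘ₗ toWedge k N n

lemma coeff_linExp_rename_eq_zero {n : ℕ} (a : Fin (n + 1) → Fin N) (f : Fin n → Fin (n + 1))
    (t : Fin (n + 1)) (ht : ∀ s, f s ≠ t) (q : Pn k N n) :
    coeff (linExp a) (rename (Prod.map f id) q) = 0 := by
  refine coeff_rename_eq_zero _ _ _ fun u hu => ?_
  have h := DFunLike.congr_fun hu (t, a t)
  rw [linExp_apply, if_pos rfl, Finsupp.mapDomain_of_notMem_range] at h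
  · exact absurd h (by simp)
  · rintro ⟨⟨s, b⟩, hs⟩
    exact ht s (congrArg Prod.fst hs)

lemma rename_swap_coface (n : ℕ) (i : Fin n) (q : Pn k N n) :
    rename (Prod.map (Equiv.swap i.castSucc i.succ) id) (coface k N n i q) =
      coface k N n i q := by
  suffices (rename (Prod.map (Equiv.swap i.castSucc i.succ) id)).comp (coface k N n i) =
    coface k N n i from DFunLike.congr_fun this q
  ext1 ⟨s, a⟩
  rw [AlgHom.comp_apply, coface_X_eq]
  split_ifs with h
  · simp [add_comm]
  · rw [rename_X, Prod.map, id, Equiv.swap_apply_of_ne_of_ne]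
    · exact Fin.succAbove_ne _ _
    · rw [← succ_succAbove_of_ne h]
      exact Fin.succAbove_ne _ _

lemma toWedge_coface (n : ℕ) (i : Fin n) (q : Pn k N n) :
    toWedge k N (n + 1) (coface k N n i q) = 0 := by
  rw [toWedge_apply]
  set τ := Equiv.swap i.castSucc i.succ with hτ
  set S := ∑ a : Fin (n + 1) → Fin N,
    coeff (linExp a) (coface k N n i q) • basisWedge k N (n + 1) a with hS
  have hc (a : Fin (n + 1) → Fin N) : coeff (linExp (a ∘ τ)) (coface k N n i q) =
      coeff (linExp a) (coface k N n i q) := by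
    conv_rhs => rw [← rename_swap_coface, ← mapDomain_linExp a τ]
    rw [coeff_rename_mapDomain]
    exact τ.injective.prodMap Function.injective_id
  have hsign : Equiv.Perm.sign τ = -1 := Equiv.Perm.sign_swap Fin.castSucc_lt_succ.ne
  have h : S = -S := by
    conv_lhs => rw [hS]
    rw [← Equiv.sum_comp (Equiv.arrowCongr τ (Equiv.refl (Fin N))), hS, ← Finset.sum_neg_distrib]
    refine Finset.sum_congr rfl fun a _ => ?_
    have : Equiv.arrowCongr τ (Equiv.refl (Fin N)) a = a ∘ τ := by
      funext s; simp [hτ]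
    rw [this, hc, basisWedge_comp_perm, hsign]
    simp
  have h2 : (2 : k) • S = 0 := by rw [two_smul]; nth_rw 1 [h]; simp
  rw [(smul_eq_zero.mp h2).resolve_left two_ne_zero, smul_zero]

lemma toWedge_cobar (n : ℕ) (q : Pn k N n) : toWedge k N (n + 1) (cobar k N n q) = 0 := by
  have h1 : toWedge k N (n + 1) (rename (Prod.map Fin.succ id) q) = 0 := by
    simp [toWedge_apply, coeff_linExp_rename_eq_zero _ Fin.succ 0 Fin.succ_ne_zero]
  have h2 : toWedge k N (n + 1) (rename (Prod.map Fin.castSucc id) q) = 0 := by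
    simp [toWedge_apply, coeff_linExp_rename_eq_zero _ Fin.castSucc (Fin.last n)
      fun s => (Fin.castSucc_lt_last s).ne]
  simp [cobar_apply, h1, h2, toWedge_coface]

lemma linMon_comp_perm_sub_mem (n : ℕ) (a : Fin (n + 1) → Fin N) (σ : Equiv.Perm (Fin (n + 1))) :
    linMon k N (n + 1) a - Equiv.Perm.sign σ • linMon k N (n + 1) (a ∘ σ) ∈
      LinearMap.range (cobar k N n) := by
  have hσ : σ ∈ Submonoid.closure
      (Set.range fun i : Fin n => Equiv.swap i.castSucc i.succ) := by
    rw [Equiv.Perm.mclosure_swap_castSucc_succ]; trivial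
  induction hσ using Submonoid.closure_induction generalizing a with
  | mem σ hσ =>
    obtain ⟨i, rfl⟩ := hσ
    have := linMon_add_linMon_swap_mem (k := k) n a i
    simpa [Equiv.Perm.sign_swap Fin.castSucc_lt_succ.ne] using this
  | one => simp
  | mul x y _ _ hx hy =>
    have h1 := hx a
    have h2 := hy (a ∘ x)
    have h3 : Equiv.Perm.sign x • (linMon k N (n + 1) (a ∘ x) -
        Equiv.Perm.sign y • linMon k N (n + 1) ((a ∘ x) ∘ y)) ∈ LinearMap.range (cobar k N n) := by
      rw [Units.smul_def]
      exact zsmul_mem h2 _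
    have := add_mem h1 h3
    rw [smul_sub, smul_smul, ← map_mul, sub_add_sub_cancel] at this
    exact this

lemma sub_altProj_linMon_mem (n : ℕ) (a : Fin (n + 1) → Fin N) :
    linMon k N (n + 1) a - altProj k N (n + 1) (linMon k N (n + 1) a) ∈
      LinearMap.range (cobar k N n) := by
  have hn : ((n + 1).factorial : k) ≠ 0 := by exact_mod_cast (n + 1).factorial_ne_zero
  have h : linMon k N (n + 1) a - altProj k N (n + 1) (linMon k N (n + 1) a) =
      ((n + 1).factorial : k)⁻¹ • ∑ σ : Equiv.Perm (Fin (n + 1)),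
        (linMon k N (n + 1) a - Equiv.Perm.sign σ • linMon k N (n + 1) (a ∘ σ)) := by
    rw [altProj, LinearMap.comp_apply, toWedge_linMon, map_smul, altPlace_basisWedge,
      Finset.sum_sub_distrib, smul_sub]
    congr 1
    simp [Fintype.card_perm, ← Nat.cast_smul_eq_nsmul k, smul_smul, hn]
  rw [h]
  exact Submodule.smul_mem _ _ (sum_mem fun σ _ => linMon_comp_perm_sub_mem n a σ)

lemma sub_altProj_mem (n : ℕ) {q : Pn k N (n + 1)} (hq : cobar k N (n + 1) q = 0) :
    q - altProj k N (n + 1) q ∈ LinearMap.range (cobar k N n) := by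
  obtain ⟨l, hl, r, rfl⟩ := exists_linMon_add_cobar n hq
  have h0 : altProj k N (n + 1) (cobar k N n r) = 0 := by
    rw [altProj, LinearMap.comp_apply, toWedge_cobar, map_zero]
  rw [map_add, h0, add_zero, add_sub_right_comm]
  refine add_mem ?_ ⟨r, rfl⟩
  clear hq
  induction hl using Submodule.span_induction with
  | mem l hl =>
    obtain ⟨a, rfl⟩ := hl
    exact sub_altProj_linMon_mem n a
  | zero => simp
  | add x y _ _ hx hy => rw [map_add, add_sub_add_comm]; exact add_mem hx hy
  | smul c x _ hx => rw [map_smul, ← smul_sub]; exact Submodule.smul_mem _ _ hx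

/-- Over a field, a projection onto representatives of cohomology extends to a contracting
homotopy. -/
lemma exists_homotopy {U V V' : Type} [AddCommGroup U] [Module k U] [AddCommGroup V] [Module k V]
    [AddCommGroup V'] [Module k V'] (d₀ : U →ₗ[k] V) (d₁ : V →ₗ[k] V') (A : V →ₗ[k] V)
    (h : ∀ v, d₁ v = 0 → v - A v ∈ LinearMap.range d₀) :
    ∃ (s : V →ₗ[k] U) (g : V' →ₗ[k] V), (d₀ = 0 → s = 0) ∧
      ∀ v, v = A v + d₀ (s v) + g (d₁ v) := by
  obtain ⟨s, hs0, hs⟩ : ∃ s : V →ₗ[k] U, (d₀ = 0 → s = 0) ∧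
      ∀ v, d₁ v = 0 → d₀ (s v) = v - A v := by
    by_cases hd : d₀ = 0
    · refine ⟨0, fun _ => rfl, fun v hv => ?_⟩
      have := h v hv
      simp only [hd, LinearMap.range_zero, Submodule.mem_bot] at this
      simp [this]
    · obtain ⟨t, ht⟩ := Module.projective_lifting_property d₀.rangeRestrict
        (((LinearMap.id - A) ∘ₗ (LinearMap.ker d₁).subtype).codRestrict (LinearMap.range d₀)
          fun v => h v v.2) d₀.surjective_rangeRestrict
      obtain ⟨s, hs⟩ := LinearMap.exists_extend t
      refine ⟨s, fun h => absurd h hd, fun v hv => ?_⟩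
      have h1 : s v = t ⟨v, hv⟩ := DFunLike.congr_fun hs ⟨v, hv⟩
      have h2 := congrArg Subtype.val (DFunLike.congr_fun ht ⟨v, hv⟩)
      rw [h1]
      exact h2
  obtain ⟨t, ht⟩ := LinearMap.exists_rightInverse_of_surjective d₁.rangeRestrict
    d₁.range_rangeRestrict
  obtain ⟨g, hg⟩ := LinearMap.exists_extend ((LinearMap.id - A - d₀ ∘ₗ s) ∘ₗ t)
  refine ⟨s, g, hs0, fun v => ?_⟩
  let y : LinearMap.range d₁ := ⟨d₁ v, v, rfl⟩
  have h1 : g (d₁ v) = (LinearMap.id - A - d₀ ∘ₗ s : V →ₗ[k] V) (t y) :=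
    DFunLike.congr_fun hg y
  have h2 : d₁ (t y) = d₁ v :=
    congrArg (fun x : LinearMap.range d₁ => (x : V')) (DFunLike.congr_fun ht y)
  have h3 := hs (v - t y) (by rw [map_sub, h2, sub_self])
  simp only [map_sub, LinearMap.sub_apply, LinearMap.id_apply, LinearMap.comp_apply] at h1 h3
  rw [h1]
  rw [sub_eq_iff_eq_add] at h3
  rw [add_assoc (A v), h3]
  abel

lemma cobar_zero_eq_zero : cobar k N 0 = 0 := by
  refine LinearMap.ext fun q => ?_
  have : (Prod.map Fin.succ id : Fin 0 × Fin N → Fin 1 × Fin N) = Prod.map Fin.castSucc id :=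
    funext fun p => p.1.elim0
  simp [cobar_apply, this]

variable (k N) in
lemma exists_cobar_homotopy (n : ℕ) :
    ∃ (s : Pn k N (n + 1) →ₗ[k] Pn k N n) (g : Pn k N (n + 2) →ₗ[k] Pn k N (n + 1)),
      (n = 0 → s = 0) ∧
      ∀ q, q = altProj k N (n + 1) q + cobar k N n (s q) + g (cobar k N (n + 1) q) := by
  obtain ⟨s, g, hs, h⟩ := exists_homotopy (cobar k N n) (cobar k N (n + 1)) (altProj k N (n + 1))
    fun _ => sub_altProj_mem n
  refine ⟨s, g, ?_, h⟩
  rintro rfl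
  exact hs cobar_zero_eq_zero

end Alternating

section Symbols

variable {k N}

set_option linter.unusedSectionVars false

open scoped TensorProduct

open scoped IsMulCommutative in
variable (k) in
/-- The constant coefficient differential operator with a given symbol. -/
def diffOp (σ : Type) : MvPolynomial σ k →ₐ[k] Module.End k (MvPolynomial σ k) :=
  haveI := Algebra.isMulCommutative_adjoin k
    (s := Set.range fun p : σ => ((pderiv p).toLinearMap : Module.End k (MvPolynomial σ k))) (by
      rintro _ ⟨p, rfl⟩ _ ⟨q, rfl⟩
      exact LinearMap.ext fun f => pderiv_pderiv_comm p q f)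
  (Algebra.adjoin k
    (Set.range fun p : σ => ((pderiv p).toLinearMap : Module.End k (MvPolynomial σ k)))).val.comp
    (aeval fun p => ⟨(pderiv p).toLinearMap, Algebra.subset_adjoin ⟨p, rfl⟩⟩)

variable {σ τ ρ : Type}

lemma diffOp_X (p : σ) (f : MvPolynomial σ k) : diffOp k σ (X p) f = pderiv p f := by
  simp [diffOp]

lemma diffOp_C (c : k) (f : MvPolynomial σ k) : diffOp k σ (C c) f = c • f := by
  rw [← algebraMap_eq, AlgHom.commutes, Module.algebraMap_end_apply]

lemma diffOp_mul (p q f : MvPolynomial σ k) :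
    diffOp k σ (p * q) f = diffOp k σ p (diffOp k σ q f) := by
  rw [map_mul, Module.End.mul_apply]

lemma diffOp_algHom (φ : MvPolynomial σ k →ₐ[k] MvPolynomial τ k)
    (ψ : MvPolynomial τ k →ₐ[k] MvPolynomial σ k)
    (h : ∀ q f, pderiv q (φ f) = φ (diffOp k σ (ψ (X q)) f)) (p : MvPolynomial τ k)
    (f : MvPolynomial σ k) : diffOp k τ p (φ f) = φ (diffOp k σ (ψ p) f) := by
  induction p using MvPolynomial.induction_on generalizing f with
  | C a => simp [← algebraMap_eq, Module.algebraMap_end_apply]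
  | add p q hp hq => simp [hp, hq]
  | mul_X p i hp => rw [diffOp_mul, map_mul ψ, diffOp_mul, diffOp_X, h, hp]

lemma diffOp_algHom_of_pderiv [Fintype σ] (φ : MvPolynomial σ k →ₐ[k] MvPolynomial τ k)
    (ψ : MvPolynomial τ k →ₐ[k] MvPolynomial σ k) (M : τ → σ → k)
    (hφ : ∀ q j, pderiv q (φ (X j)) = C (M q j)) (hψ : ∀ q, ψ (X q) = ∑ j, C (M q j) * X j)
    (p : MvPolynomial τ k) (f : MvPolynomial σ k) :
    diffOp k τ p (φ f) = φ (diffOp k σ (ψ p) f) := by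
  refine diffOp_algHom φ ψ (fun q f => ?_) p f
  rw [pderiv_algHom, hψ]
  simp [hφ, diffOp_X, smul_eq_C_mul, ← algebraMap_eq]

lemma diffOp_rename_mul_rename {f : ρ → τ} {g : σ → τ} (hg : Function.Injective g)
    (hfg : ∀ x y, f x ≠ g y) (p : MvPolynomial σ k) (u : MvPolynomial ρ k)
    (v : MvPolynomial σ k) : diffOp k τ (rename g p) (rename f u * rename g v) =
      rename f u * rename g (diffOp k σ p v) := by
  induction p using MvPolynomial.induction_on generalizing v with
  | C a => simp
  | add p q hp hq => simp [hp, hq, mul_add]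
  | mul_X p i hp =>
    have hu : pderiv (g i) (rename f u) = 0 := by
      refine pderiv_eq_zero_of_notMem_vars fun h => ?_
      classical
      obtain ⟨x, _, hx⟩ := Finset.mem_image.mp (vars_rename f u h)
      exact hfg _ _ hx
    rw [map_mul (rename g), diffOp_mul, diffOp_mul, rename_X, diffOp_X, diffOp_X, pderiv_mul, hu, zero_mul,
      zero_add, pderiv_rename hg, hp]

lemma diffOp_X_mul (p : MvPolynomial σ k) (i : σ) (f : MvPolynomial σ k) :
    diffOp k σ p (X i * f) = X i * diffOp k σ p f + diffOp k σ (pderiv i p) f := by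
  classical
  induction p using MvPolynomial.induction_on generalizing f with
  | C a => simp
  | add p q hp hq => simp only [map_add, LinearMap.add_apply, hp, hq]; ring
  | mul_X p j hp =>
    simp only [diffOp_mul, diffOp_X, pderiv_mul, map_add, hp, LinearMap.add_apply, pderiv_X,
      Pi.single_apply, eq_comm (a := i) (b := j)]
    split_ifs
    · simp; ring
    · simp

lemma diffOp_one_right (p : MvPolynomial σ k) : diffOp k σ p 1 = C (coeff 0 p) := by
  induction p using MvPolynomial.induction_on with
  | C a => simp [smul_eq_C_mul]
  | add p q hp hq => simp [hp, hq]
  | mul_X p i hp => rw [diffOp_mul, diffOp_X]; simp [← constantCoeff_eq]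

lemma coeff_diffOp_monomial (μ : σ →₀ ℕ) : ∃ c : (σ →₀ ℕ) → k, (∀ ν, c ν ≠ 0) ∧
    ∀ ν f, coeff ν (diffOp k σ (monomial μ 1) f) = c ν * coeff (ν + μ) f := by
  have hadd (μ μ' : σ →₀ ℕ)
      (h : ∃ c : (σ →₀ ℕ) → k, (∀ ν, c ν ≠ 0) ∧
        ∀ ν f, coeff ν (diffOp k σ (monomial μ 1) f) = c ν * coeff (ν + μ) f)
      (h' : ∃ c : (σ →₀ ℕ) → k, (∀ ν, c ν ≠ 0) ∧
        ∀ ν f, coeff ν (diffOp k σ (monomial μ' 1) f) = c ν * coeff (ν + μ') f) :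
      ∃ c : (σ →₀ ℕ) → k, (∀ ν, c ν ≠ 0) ∧
        ∀ ν f, coeff ν (diffOp k σ (monomial (μ + μ') 1) f) = c ν * coeff (ν + (μ + μ')) f := by
    obtain ⟨c, hc, hc'⟩ := h
    obtain ⟨d, hd, hd'⟩ := h'
    refine ⟨fun ν => c ν * d (ν + μ), fun ν => mul_ne_zero (hc _) (hd _), fun ν f => ?_⟩
    have : (monomial (μ + μ') 1 : MvPolynomial σ k) = monomial μ 1 * monomial μ' 1 := by
      simp [monomial_mul]
    rw [this, diffOp_mul, hc', hd', mul_assoc, add_assoc]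
  have h0 : ∃ c : (σ →₀ ℕ) → k, (∀ ν, c ν ≠ 0) ∧
      ∀ ν f, coeff ν (diffOp k σ (monomial 0 1) f) = c ν * coeff (ν + 0) f :=
    ⟨fun _ => 1, fun _ => one_ne_zero, fun ν f => by
      rw [← C_apply, diffOp_C]; simp⟩
  induction μ using Finsupp.induction_linear with
  | zero => exact h0
  | add μ μ' h h' => exact hadd μ μ' h h'
  | single p n =>
    induction n with
    | zero => simpa using h0
    | succ n ih =>
      rw [Finsupp.single_add]
      refine hadd _ _ ih ⟨fun ν => (ν p + 1 : k), fun ν => Nat.cast_add_one_ne_zero _,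
        fun ν f => ?_⟩
      have : (monomial (Finsupp.single p 1) 1 : MvPolynomial σ k) = X p := rfl
      rw [this, diffOp_X, coeff_pderiv, mul_comm]

variable (k N) in
/-- The polydifferential operator with a given symbol. -/
def symb (m n : ℕ) : Pn k N m ⊗[k] Pn k N n →ₗ[k] Pn k N m →ₗ[k] Pn k N n :=
  TensorProduct.lift <| LinearMap.mk₂ k
    (fun p q => LinearMap.mulLeft k q ∘ₗ (spread k N m n).toLinearMap ∘ₗ diffOp k _ p)
    (fun p p' q => LinearMap.ext fun f => by simp [mul_add])
    (fun c p q => LinearMap.ext fun f => by simp)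
    (fun p q q' => LinearMap.ext fun f => by simp [add_mul])
    (fun c p q => LinearMap.ext fun f => by simp)

lemma symb_tmul (m n : ℕ) (p : Pn k N m) (q : Pn k N n) (f : Pn k N m) :
    symb k N m n (p ⊗ₜ q) f = q * spread k N m n (diffOp k _ p f) := rfl

lemma symb_rTensor_pderiv (m n : ℕ) (i : Fin m × Fin N) (z : Pn k N m ⊗[k] Pn k N n)
    (f : Pn k N m) : symb k N m n ((pderiv i).toLinearMap.rTensor _ z) f =
      symb k N m n z (X i * f) - spread k N m n (X i) * symb k N m n z f := by
  induction z using TensorProduct.induction_on with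
  | zero => simp
  | add z z' h h' => simp only [map_add, LinearMap.add_apply, h, h']; ring
  | tmul p q =>
    rw [LinearMap.rTensor_tmul, symb_tmul, symb_tmul, symb_tmul, diffOp_X_mul, map_add, map_mul]
    simp only [Derivation.coeFn_coe]
    ring

lemma symb_rTensor_diffOp (m n : ℕ) (r : Pn k N m) (z : Pn k N m ⊗[k] Pn k N n)
    (hz : symb k N m n z = 0) : symb k N m n ((diffOp k _ r).rTensor _ z) = 0 := by
  induction r using MvPolynomial.induction_on generalizing z with
  | C a =>
    rw [← algebraMap_eq, AlgHom.commutes, Algebra.algebraMap_eq_smul_one, LinearMap.rTensor_smul,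
      LinearMap.smul_apply, Module.End.one_eq_id, LinearMap.rTensor_id, LinearMap.id_apply,
      map_smul, hz, smul_zero]
  | add p q hp hq =>
    rw [map_add, LinearMap.rTensor_add, LinearMap.add_apply, map_add, hp z hz, hq z hz, add_zero]
  | mul_X p i hp =>
    have h : diffOp k _ (p * X i) = diffOp k _ p ∘ₗ (pderiv i).toLinearMap :=
      LinearMap.ext fun f => by rw [diffOp_mul, diffOp_X]; rfl
    rw [h, LinearMap.rTensor_comp, LinearMap.comp_apply]
    refine hp _ (LinearMap.ext fun f => ?_)
    simp [symb_rTensor_pderiv, hz]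

lemma symb_apply_one (m n : ℕ) (z : Pn k N m ⊗[k] Pn k N n) :
    symb k N m n z 1 = TensorProduct.lid k _ ((lcoeff k 0).rTensor _ z) := by
  induction z using TensorProduct.induction_on with
  | zero => simp
  | add z z' h h' => simp [h, h']
  | tmul p q =>
    rw [symb_tmul, diffOp_one_right, ← algebraMap_eq, AlgHom.commutes]
    simp [Algebra.smul_def, mul_comm]

lemma symb_injective (m n : ℕ) : Function.Injective (symb k N m n) := by
  rw [← LinearMap.ker_eq_bot, LinearMap.ker_eq_bot']
  intro z hz
  have hcoeff (z : Pn k N m ⊗[k] Pn k N n) (μ : (Fin m × Fin N) →₀ ℕ) :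
      TensorProduct.equivFinsuppOfBasisLeft (basisMonomials _ k) z μ =
        TensorProduct.lid k _ ((lcoeff k μ).rTensor _ z) := by
    induction z using TensorProduct.induction_on with
    | zero => simp
    | add z z' h h' => simp [h, h']
    | tmul p q =>
      rw [TensorProduct.equivFinsuppOfBasisLeft_apply_tmul_apply]
      rfl
  refine (TensorProduct.equivFinsuppOfBasisLeft (basisMonomials _ k)).map_eq_zero_iff.mp ?_
  ext1 μ
  obtain ⟨c, hc, hc'⟩ := coeff_diffOp_monomial (k := k) μ
  have h := symb_apply_one m n ((diffOp k _ (monomial μ 1)).rTensor _ z)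
  have hl : lcoeff k 0 ∘ₗ diffOp k _ (monomial μ 1) = c 0 • lcoeff k μ :=
    LinearMap.ext fun f => by simp [hc']
  rw [symb_rTensor_diffOp m n _ z hz, ← LinearMap.comp_apply, ← LinearMap.rTensor_comp, hl,
    LinearMap.rTensor_smul, LinearMap.smul_apply, map_smul, ← hcoeff, LinearMap.zero_apply] at h
  exact (smul_eq_zero.mp h.symm).resolve_left (hc 0)

lemma derivOp_eq_diffOp (m : ℕ) (Is : Fin m → List (Fin N)) :
    derivOp k N m Is = diffOp k _ (xMon k N m Is) := by
  have h : xMon k N m Is = (((List.finRange m).flatMap fun s =>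
      (Is s).map fun i => ((s, i) : Fin m × Fin N)).map fun p => (X p : Pn k N m)).prod := by
    rw [xMon, List.map_flatMap, List.flatMap_def, List.prod_flatten, List.map_map, ← List.prod_ofFn, List.ofFn_eq_map]
    simp [Function.comp_def]
  rw [h, derivOp]
  generalize (List.finRange m).flatMap (fun s =>
    (Is s).map fun i => ((s, i) : Fin m × Fin N)) = l
  induction l with
  | nil => exact (map_one (diffOp k (Fin m × Fin N))).symm
  | cons p l ih =>
    rw [List.foldr_cons, ih]
    refine LinearMap.ext fun f => ?_
    rw [List.map_cons, List.prod_cons, diffOp_mul, diffOp_X]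
    rfl

lemma span_range_xMon (n : ℕ) : Submodule.span k (Set.range (xMon k N n)) = ⊤ := by
  rw [eq_top_iff]
  rintro p -
  induction p using MvPolynomial.induction_on with
  | C a =>
    have : C a = a • xMon k N n fun _ => [] := by simp [xMon, smul_eq_C_mul]
    rw [this]
    exact Submodule.smul_mem _ _ (Submodule.subset_span ⟨_, rfl⟩)
  | add p q hp hq => exact add_mem hp hq
  | mul_X p i hp =>
    induction hp using Submodule.span_induction with
    | mem p hp =>
      obtain ⟨Js, rfl⟩ := hp
      refine Submodule.subset_span ⟨Function.update Js i.1 (i.2 :: Js i.1), ?_⟩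
      rw [xMon, xMon, ← Finset.mul_prod_erase _ _ (Finset.mem_univ i.1),
        ← Finset.mul_prod_erase _ (fun t => (List.map _ (Js t)).prod) (Finset.mem_univ i.1),
        Function.update_self, List.map_cons, List.prod_cons, mul_assoc, mul_comm]
      congr 2
      refine Finset.prod_congr rfl fun t ht => ?_
      rw [Function.update_of_ne (Finset.ne_of_mem_erase ht)]
    | zero => simp
    | add p q _ _ hp hq => rw [add_mul]; exact add_mem hp hq
    | smul c p _ hp => rw [smul_mul_assoc]; exact Submodule.smul_mem _ _ hp

lemma polyHom_eq_range_symb (m n : ℕ) : polyHom k N m n = LinearMap.range (symb k N m n) := by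
  have hΓ (Is : Fin m → List (Fin N)) (Js : Fin n → List (Fin N)) :
      Γop k N m n Is Js = symb k N m n (xMon k N m Is ⊗ₜ xMon k N n Js) := by
    rw [Γop, derivOp_eq_diffOp]; rfl
  refine le_antisymm (Submodule.span_le.mpr ?_) ?_
  · rintro _ ⟨Is, Js, rfl⟩
    exact ⟨_, (hΓ Is Js).symm⟩
  · rintro _ ⟨z, rfl⟩
    induction z using TensorProduct.induction_on with
    | zero => simp
    | add z z' h h' => rw [map_add]; exact add_mem h h'
    | tmul p q =>
      have hp : p ∈ Submodule.span k (Set.range (xMon k N m)) := by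
        rw [span_range_xMon]; trivial
      have hq : q ∈ Submodule.span k (Set.range (xMon k N n)) := by
        rw [span_range_xMon]; trivial
      induction hp, hq using Submodule.span_induction₂ with
      | mem_mem p q hp hq =>
        obtain ⟨Is, rfl⟩ := hp
        obtain ⟨Js, rfl⟩ := hq
        exact Submodule.subset_span ⟨Is, Js, (hΓ Is Js).symm⟩
      | zero_left => simp
      | zero_right => simp
      | add_left p p' q _ _ _ h h' => rw [TensorProduct.add_tmul, map_add]; exact add_mem h h'
      | add_right p q q' _ _ _ h h' => rw [TensorProduct.tmul_add, map_add]; exact add_mem h h'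
      | smul_left c p q _ _ h =>
        rw [← TensorProduct.smul_tmul', map_smul]; exact Submodule.smul_mem _ _ h
      | smul_right c p q _ _ h =>
        rw [TensorProduct.tmul_smul, map_smul]; exact Submodule.smul_mem _ _ h

end Symbols

section Differentials

variable {k N}

set_option linter.unusedSectionVars false

open scoped TensorProduct

lemma monomial_frontExp_mul_restExp (m : ℕ) (μ : (Fin (m + 1) × Fin N) →₀ ℕ) :
    (rename (Prod.mk 0) (monomial (frontExp N m μ) (1 : k)) *
      rename (Prod.map Fin.succ id) (monomial (restExp N m μ) (1 : k)) : Pn k N (m + 1)) =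
      monomial μ 1 := by
  have hinj : Function.Injective (Prod.map (Fin.succ (n := m)) (id : Fin N → Fin N)) :=
    (Fin.succ_injective m).prodMap Function.injective_id
  have h : Finsupp.mapDomain (Prod.mk 0) (frontExp N m μ) +
      Finsupp.mapDomain (Prod.map Fin.succ id) (restExp N m μ) = μ := by
    ext ⟨s, a⟩
    rw [Finsupp.add_apply]
    induction s using Fin.cases with
    | zero =>
      rw [Finsupp.mapDomain_apply (Prod.mk_right_injective _), Finsupp.mapDomain_of_notMem_range]
      · rfl
      · rintro ⟨⟨t, b⟩, ht⟩
        exact Fin.succ_ne_zero t (congrArg Prod.fst ht)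
    | succ s =>
      rw [Finsupp.mapDomain_of_notMem_range, zero_add]
      · exact (Finsupp.mapDomain_apply hinj _ (s, a)).trans rfl
      · rintro ⟨b, hb⟩
        exact Fin.succ_ne_zero s (congrArg Prod.fst hb).symm
  rw [rename_monomial, rename_monomial, monomial_mul, one_mul, h]

lemma monomial_initExp_mul_lastExp (m : ℕ) (μ : (Fin (m + 1) × Fin N) →₀ ℕ) :
    (rename (Prod.map Fin.castSucc id) (monomial (initExp N m μ) (1 : k)) *
      rename (Prod.mk (Fin.last m)) (monomial (lastExp N m μ) (1 : k)) : Pn k N (m + 1)) =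
      monomial μ 1 := by
  have hinj : Function.Injective (Prod.map (Fin.castSucc (n := m)) (id : Fin N → Fin N)) :=
    (Fin.castSucc_injective m).prodMap Function.injective_id
  have h : Finsupp.mapDomain (Prod.map Fin.castSucc id) (initExp N m μ) +
      Finsupp.mapDomain (Prod.mk (Fin.last m)) (lastExp N m μ) = μ := by
    ext ⟨s, a⟩
    rw [Finsupp.add_apply]
    induction s using Fin.lastCases with
    | last =>
      rw [Finsupp.mapDomain_apply (Prod.mk_right_injective _), Finsupp.mapDomain_of_notMem_range]
      · exact zero_add _
      · rintro ⟨⟨t, b⟩, ht⟩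
        exact (Fin.castSucc_lt_last t).ne (congrArg Prod.fst ht)
    | cast s =>
      rw [Finsupp.mapDomain_of_notMem_range (lastExp N m μ), add_zero]
      · exact (Finsupp.mapDomain_apply hinj _ (s, a)).trans rfl
      · rintro ⟨b, hb⟩
        exact (Fin.castSucc_lt_last s).ne (congrArg Prod.fst hb).symm
  rw [rename_monomial, rename_monomial, monomial_mul, one_mul, h]

lemma termA_eq {m n : ℕ} {f : Pn k N m →ₗ[k] Pn k N n} {T : Pn k N (m + 1) →ₗ[k] Pn k N n}
    (h : ∀ u v, T (rename (Prod.mk 0) u * rename (Prod.map Fin.succ id) v) =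
      Δiter k N n u * f v) : termA k N m n f = T := by
  refine (basisMonomials _ k).ext fun μ => ?_
  rw [termA, Module.Basis.constr_basis, ← h, monomial_frontExp_mul_restExp, coe_basisMonomials]

lemma termC_eq {m n : ℕ} {f : Pn k N m →ₗ[k] Pn k N n} {T : Pn k N (m + 1) →ₗ[k] Pn k N n}
    (h : ∀ u v, T (rename (Prod.map Fin.castSucc id) v * rename (Prod.mk (Fin.last m)) u) =
      f v * Δiter k N n u) : termC k N m n f = T := by
  refine (basisMonomials _ k).ext fun μ => ?_
  rw [termC, Module.Basis.constr_basis, ← h, monomial_initExp_mul_lastExp, coe_basisMonomials]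

lemma lextend_eq {m n : ℕ} {f : Pn k N m →ₗ[k] Pn k N n}
    {T : Pn k N (m + 1) →ₗ[k] Pn k N (n + 1)}
    (h : ∀ u v, T (rename (Prod.mk 0) u * rename (Prod.map Fin.succ id) v) =
      rename (Prod.mk 0) u * rename (Prod.map Fin.succ id) (f v)) : lextend k N m n f = T := by
  refine (basisMonomials _ k).ext fun μ => ?_
  rw [lextend, Module.Basis.constr_basis, ← rename_monomial, ← h, monomial_frontExp_mul_restExp,
    coe_basisMonomials]

lemma rextend_eq {m n : ℕ} {f : Pn k N m →ₗ[k] Pn k N n}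
    {T : Pn k N (m + 1) →ₗ[k] Pn k N (n + 1)}
    (h : ∀ u v, T (rename (Prod.map Fin.castSucc id) v * rename (Prod.mk (Fin.last m)) u) =
      rename (Prod.map Fin.castSucc id) (f v) * rename (Prod.mk (Fin.last n)) u) :
    rextend k N m n f = T := by
  refine (basisMonomials _ k).ext fun μ => ?_
  rw [rextend, Module.Basis.constr_basis, ← rename_monomial, ← h, monomial_initExp_mul_lastExp,
    coe_basisMonomials]

lemma spread_rename_mk (m n : ℕ) (s : Fin m) (u : MvPolynomial (Fin N) k) :
    spread k N m n (rename (Prod.mk s) u) = Δiter k N n u := by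
  rw [spread, aeval_rename, Δiter]; rfl

lemma spread_rename_map (m m' n : ℕ) (f : Fin m → Fin m') (v : Pn k N m) :
    spread k N m' n (rename (Prod.map f id) v) = spread k N m n v := by
  rw [spread, aeval_rename, spread]; rfl

lemma diffOp_rename_succ_mul (m : ℕ) (p v : Pn k N m) (u : MvPolynomial (Fin N) k) :
    diffOp k _ (rename (Prod.map Fin.succ id) p)
      (rename (Prod.mk (0 : Fin (m + 1))) u * rename (Prod.map Fin.succ id) v) =
      rename (Prod.mk 0) u * rename (Prod.map Fin.succ id) (diffOp k _ p v) :=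
  diffOp_rename_mul_rename ((Fin.succ_injective m).prodMap Function.injective_id)
    (fun x y h => Fin.succ_ne_zero y.1 (congrArg Prod.fst (id h : (0, x) = Prod.map Fin.succ id y)).symm) p u v

lemma diffOp_rename_castSucc_mul (m : ℕ) (p v : Pn k N m) (u : MvPolynomial (Fin N) k) :
    diffOp k _ (rename (Prod.map Fin.castSucc id) p)
      (rename (Prod.map Fin.castSucc id) v * rename (Prod.mk (Fin.last m)) u) =
      rename (Prod.map Fin.castSucc id) (diffOp k _ p v) * rename (Prod.mk (Fin.last m)) u := by
  rw [mul_comm, mul_comm (rename (Prod.map Fin.castSucc id) _)]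
  exact diffOp_rename_mul_rename ((Fin.castSucc_injective m).prodMap Function.injective_id)
    (fun x y h => (Fin.castSucc_lt_last y.1).ne
      (congrArg Prod.fst (id h : (Fin.last m, x) = Prod.map Fin.castSucc id y)).symm) p u v

lemma termA_symb (m n : ℕ) (z : Pn k N m ⊗[k] Pn k N n) :
    termA k N m n (symb k N m n z) = symb k N (m + 1) n
      ((rename (R := k) (Prod.map Fin.succ (id : Fin N → Fin N))).toLinearMap.rTensor _ z) := by
  refine termA_eq fun u v => ?_
  induction z using TensorProduct.induction_on with
  | zero => simp
  | add z z' h h' => simp only [map_add, LinearMap.add_apply, h, h', mul_add]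
  | tmul p q =>
    rw [LinearMap.rTensor_tmul, symb_tmul, symb_tmul, AlgHom.toLinearMap_apply,
      diffOp_rename_succ_mul, map_mul, spread_rename_mk, spread_rename_map, mul_left_comm]

lemma termC_symb (m n : ℕ) (z : Pn k N m ⊗[k] Pn k N n) :
    termC k N m n (symb k N m n z) = symb k N (m + 1) n
      ((rename (R := k) (Prod.map Fin.castSucc (id : Fin N → Fin N))).toLinearMap.rTensor _ z) := by
  refine termC_eq fun u v => ?_
  induction z using TensorProduct.induction_on with
  | zero => simp
  | add z z' h h' => simp only [map_add, LinearMap.add_apply, h, h', add_mul]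
  | tmul p q =>
    rw [LinearMap.rTensor_tmul, symb_tmul, symb_tmul, AlgHom.toLinearMap_apply,
      diffOp_rename_castSucc_mul, map_mul, spread_rename_mk, spread_rename_map, mul_assoc]

lemma diffOp_rename_predAbove (m : ℕ) (i : Fin m) (p : Pn k N m) (f : Pn k N (m + 1)) :
    diffOp k _ p (rename (Prod.map i.predAbove id) f) =
      rename (Prod.map i.predAbove id) (diffOp k _ (coface k N m i p) f) := by
  refine diffOp_algHom_of_pderiv _ _
    (fun q j => if i.predAbove j.1 = q.1 ∧ j.2 = q.2 then 1 else 0) ?_ ?_ p f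
  · rintro ⟨s, a⟩ ⟨r, b⟩
    classical
    simp [pderiv_X, Pi.single_apply, apply_ite]
  · rintro ⟨s, a⟩
    rw [coface_X, Fintype.sum_prod_type]
    refine Finset.sum_congr rfl fun r _ => ?_
    rw [Finset.sum_eq_single a]
    · split_ifs <;> simp_all
    · intro b _ hb
      simp [hb]
    · simp

lemma symb_comp_rename_predAbove (m n : ℕ) (i : Fin m) (z : Pn k N m ⊗[k] Pn k N n) :
    symb k N m n z ∘ₗ (rename (Prod.map i.predAbove id)).toLinearMap =
      symb k N (m + 1) n ((coface k N m i).toLinearMap.rTensor _ z) := by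
  refine LinearMap.ext fun f => ?_
  induction z using TensorProduct.induction_on with
  | zero => simp
  | add z z' h h' =>
    simp only [LinearMap.comp_apply, map_add, LinearMap.add_apply] at h h' ⊢
    rw [h, h']
  | tmul p q =>
    rw [LinearMap.rTensor_tmul, LinearMap.comp_apply, symb_tmul, symb_tmul,
      AlgHom.toLinearMap_apply, diffOp_rename_predAbove, spread_rename_map,
      AlgHom.toLinearMap_apply]

lemma cobar_eq (n : ℕ) : cobar k N n =
    (rename (R := k) (Prod.map Fin.succ (id : Fin N → Fin N))).toLinearMap +
      ∑ i : Fin n, (-1 : k) ^ ((i : ℕ) + 1) • (coface k N n i).toLinearMap +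
      (-1 : k) ^ (n + 1) •
        (rename (R := k) (Prod.map Fin.castSucc (id : Fin N → Fin N))).toLinearMap :=
  LinearMap.ext fun q => by simp [cobar_apply]

/-- On symbols, the differential `d1` is the cobar differential of the first factor. -/
lemma d1_symb (m n : ℕ) (z : Pn k N m ⊗[k] Pn k N n) :
    d1 k N m n (symb k N m n z) = symb k N (m + 1) n ((cobar k N m).rTensor _ z) := by
  simp only [d1, termA_symb, termC_symb, symb_comp_rename_predAbove, cobar_eq,
    ← LinearMap.coe_rTensorHom, map_add, map_sum, map_smul, LinearMap.add_apply,
    LinearMap.sum_apply, LinearMap.smul_apply]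

variable (k N) in
/-- The map `id_B ⊗ spread`. -/
def spreadTail (m n : ℕ) : Pn k N (m + 1) →ₐ[k] Pn k N (n + 1) :=
  aeval fun p => Fin.cases (motive := fun _ => Pn k N (n + 1)) (X (0, p.2))
    (fun _ => ∑ t : Fin n, X (t.succ, p.2)) p.1

variable (k N) in
/-- The map `spread ⊗ id_B`. -/
def spreadInit (m n : ℕ) : Pn k N (m + 1) →ₐ[k] Pn k N (n + 1) :=
  aeval fun p => Fin.lastCases (motive := fun _ => Pn k N (n + 1)) (X (Fin.last n, p.2))
    (fun _ => ∑ t : Fin n, X (t.castSucc, p.2)) p.1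

lemma spreadTail_rename_mk (m n : ℕ) (u : MvPolynomial (Fin N) k) :
    spreadTail k N m n (rename (Prod.mk 0) u) = rename (Prod.mk 0) u := by
  suffices (spreadTail k N m n).comp (rename (Prod.mk 0)) = rename (Prod.mk 0) from
    DFunLike.congr_fun this u
  ext1 a
  simp [spreadTail]

lemma spreadInit_rename_mk (m n : ℕ) (u : MvPolynomial (Fin N) k) :
    spreadInit k N m n (rename (Prod.mk (Fin.last m)) u) = rename (Prod.mk (Fin.last n)) u := by
  suffices (spreadInit k N m n).comp (rename (Prod.mk (Fin.last m))) =
    rename (Prod.mk (Fin.last n)) from DFunLike.congr_fun this u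
  ext1 a
  simp [spreadInit]

lemma spreadTail_rename_succ (m n : ℕ) (v : Pn k N m) :
    spreadTail k N m n (rename (Prod.map Fin.succ id) v) =
      rename (Prod.map Fin.succ id) (spread k N m n v) := by
  suffices (spreadTail k N m n).comp (rename (Prod.map Fin.succ id)) =
    (rename (Prod.map Fin.succ id)).comp (spread k N m n) from DFunLike.congr_fun this v
  ext1 a
  simp [spreadTail, spread]

lemma spreadInit_rename_castSucc (m n : ℕ) (v : Pn k N m) :
    spreadInit k N m n (rename (Prod.map Fin.castSucc id) v) =
      rename (Prod.map Fin.castSucc id) (spread k N m n v) := by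
  suffices (spreadInit k N m n).comp (rename (Prod.map Fin.castSucc id)) =
    (rename (Prod.map Fin.castSucc id)).comp (spread k N m n) from DFunLike.congr_fun this v
  ext1 a
  simp [spreadInit, spread]

lemma spreadTail_lam (m n : ℕ) (f : Pn k N m) :
    spreadTail k N m n (lam k N m f) = spread k N m (n + 1) f := by
  suffices (spreadTail k N m n).comp (lam k N m) = spread k N m (n + 1) from
    DFunLike.congr_fun this f
  ext1 a
  simp [spreadTail, spread, lam, Fin.sum_univ_succ]

lemma spreadInit_rhoC (m n : ℕ) (f : Pn k N m) :
    spreadInit k N m n (rhoC k N m f) = spread k N m (n + 1) f := by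
  suffices (spreadInit k N m n).comp (rhoC k N m) = spread k N m (n + 1) from
    DFunLike.congr_fun this f
  ext1 a
  simp [spreadInit, spread, rhoC, Fin.sum_univ_castSucc (n := n)]

lemma diffOp_lam (m : ℕ) (p f : Pn k N m) :
    diffOp k _ (rename (Prod.map Fin.succ id) p) (lam k N m f) = lam k N m (diffOp k _ p f) := by
  have h := diffOp_algHom_of_pderiv (lam k N m)
    (aeval fun q => Fin.cases (motive := fun _ => Pn k N m) (∑ s : Fin m, X (s, q.2))
      (fun s => X (s, q.2)) q.1)
    (fun q j => (if q.1 = 0 ∧ j.2 = q.2 then 1 else 0) +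
      if j.1.succ = q.1 ∧ j.2 = q.2 then 1 else 0) ?_ ?_
    (rename (Prod.map Fin.succ id) p) f
  · rw [h, aeval_rename]
    congr 2
    exact congrArg (diffOp k _) (aeval_X_left_apply p)
  · rintro ⟨s, a⟩ ⟨r, b⟩
    classical
    simp only [lam, aeval_X, map_add, pderiv_X, Pi.single_apply, Prod.mk.injEq, apply_ite C,
      map_one, map_zero, eq_comm]
  · rintro ⟨s, a⟩
    rw [Fintype.sum_prod_type]
    induction s using Fin.cases with
    | zero => simp [apply_ite, Fin.succ_ne_zero]
    | succ s => simp [apply_ite, Fin.succ_ne_zero, ite_and]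

lemma diffOp_rhoC (m : ℕ) (p f : Pn k N m) :
    diffOp k _ (rename (Prod.map Fin.castSucc id) p) (rhoC k N m f) =
      rhoC k N m (diffOp k _ p f) := by
  have h := diffOp_algHom_of_pderiv (rhoC k N m)
    (aeval fun q => Fin.lastCases (motive := fun _ => Pn k N m) (∑ s : Fin m, X (s, q.2))
      (fun s => X (s, q.2)) q.1)
    (fun q j => (if j.1.castSucc = q.1 ∧ j.2 = q.2 then 1 else 0) +
      if q.1 = Fin.last m ∧ j.2 = q.2 then 1 else 0) ?_ ?_
    (rename (Prod.map Fin.castSucc id) p) f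
  · rw [h, aeval_rename]
    have hX : ((fun q : Fin (m + 1) × Fin N => Fin.lastCases (motive := fun _ => Pn k N m)
        (∑ s : Fin m, X (s, q.2)) (fun s => X (s, q.2)) q.1) ∘ Prod.map Fin.castSucc id) = X :=
      funext fun q => by simp
    rw [hX, aeval_X_left_apply]
  · rintro ⟨s, a⟩ ⟨r, b⟩
    classical
    simp only [rhoC, aeval_X, map_add, pderiv_X, Pi.single_apply, Prod.mk.injEq, apply_ite C,
      map_one, map_zero, eq_comm]
  · rintro ⟨s, a⟩
    rw [Fintype.sum_prod_type]
    induction s using Fin.lastCases with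
    | last => simp [apply_ite, (Fin.castSucc_lt_last _).ne]
    | cast s => simp [apply_ite, (Fin.castSucc_lt_last _).ne, ite_and]

lemma lextend_add (m n : ℕ) (f g : Pn k N m →ₗ[k] Pn k N n) :
    lextend k N m n (f + g) = lextend k N m n f + lextend k N m n g :=
  (basisMonomials _ k).ext fun μ => by
    simp only [lextend, Module.Basis.constr_basis, LinearMap.add_apply, map_add, mul_add]

lemma lextend_zero (m n : ℕ) : lextend k N m n 0 = 0 :=
  (basisMonomials _ k).ext fun μ => by
    simp only [lextend, Module.Basis.constr_basis, LinearMap.zero_apply, map_zero, mul_zero]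

lemma rextend_add (m n : ℕ) (f g : Pn k N m →ₗ[k] Pn k N n) :
    rextend k N m n (f + g) = rextend k N m n f + rextend k N m n g :=
  (basisMonomials _ k).ext fun μ => by
    simp only [rextend, Module.Basis.constr_basis, LinearMap.add_apply, map_add, add_mul]

lemma rextend_zero (m n : ℕ) : rextend k N m n 0 = 0 :=
  (basisMonomials _ k).ext fun μ => by
    simp only [rextend, Module.Basis.constr_basis, LinearMap.zero_apply, map_zero, zero_mul]

lemma lextend_symb_tmul (m n : ℕ) (p : Pn k N m) (q : Pn k N n) :
    lextend k N m n (symb k N m n (p ⊗ₜ q)) =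
      LinearMap.mulLeft k (rename (Prod.map Fin.succ id) q) ∘ₗ
        (spreadTail k N m n).toLinearMap ∘ₗ diffOp k _ (rename (Prod.map Fin.succ id) p) := by
  refine lextend_eq fun u v => ?_
  rw [LinearMap.comp_apply, LinearMap.comp_apply, LinearMap.mulLeft_apply,
    AlgHom.toLinearMap_apply, diffOp_rename_succ_mul, map_mul, spreadTail_rename_mk,
    spreadTail_rename_succ, symb_tmul, map_mul, mul_left_comm]

lemma rextend_symb_tmul (m n : ℕ) (p : Pn k N m) (q : Pn k N n) :
    rextend k N m n (symb k N m n (p ⊗ₜ q)) =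
      LinearMap.mulLeft k (rename (Prod.map Fin.castSucc id) q) ∘ₗ
        (spreadInit k N m n).toLinearMap ∘ₗ
          diffOp k _ (rename (Prod.map Fin.castSucc id) p) := by
  refine rextend_eq fun u v => ?_
  rw [LinearMap.comp_apply, LinearMap.comp_apply, LinearMap.mulLeft_apply,
    AlgHom.toLinearMap_apply, diffOp_rename_castSucc_mul, map_mul, spreadInit_rename_mk,
    spreadInit_rename_castSucc, symb_tmul, map_mul, mul_assoc]

lemma lextend_symb_comp_lam (m n : ℕ) (z : Pn k N m ⊗[k] Pn k N n) :
    lextend k N m n (symb k N m n z) ∘ₗ (lam k N m).toLinearMap = symb k N m (n + 1)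
      ((rename (R := k) (Prod.map Fin.succ (id : Fin N → Fin N))).toLinearMap.lTensor _ z) := by
  induction z using TensorProduct.induction_on with
  | zero => simp only [map_zero, lextend_zero, LinearMap.zero_comp]
  | add z z' h h' => simp only [map_add, lextend_add, LinearMap.add_comp, h, h']
  | tmul p q =>
    refine LinearMap.ext fun f => ?_
    rw [lextend_symb_tmul, LinearMap.lTensor_tmul, symb_tmul, LinearMap.comp_apply,
      LinearMap.comp_apply, LinearMap.comp_apply, LinearMap.mulLeft_apply,
      AlgHom.toLinearMap_apply, AlgHom.toLinearMap_apply, AlgHom.toLinearMap_apply,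
      diffOp_lam, spreadTail_lam]

lemma rextend_symb_comp_rhoC (m n : ℕ) (z : Pn k N m ⊗[k] Pn k N n) :
    rextend k N m n (symb k N m n z) ∘ₗ (rhoC k N m).toLinearMap = symb k N m (n + 1)
      ((rename (R := k) (Prod.map Fin.castSucc (id : Fin N → Fin N))).toLinearMap.lTensor _ z) := by
  induction z using TensorProduct.induction_on with
  | zero => simp only [map_zero, rextend_zero, LinearMap.zero_comp]
  | add z z' h h' => simp only [map_add, rextend_add, LinearMap.add_comp, h, h']
  | tmul p q =>
    refine LinearMap.ext fun f => ?_
    rw [rextend_symb_tmul, LinearMap.lTensor_tmul, symb_tmul, LinearMap.comp_apply,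
      LinearMap.comp_apply, LinearMap.comp_apply, LinearMap.mulLeft_apply,
      AlgHom.toLinearMap_apply, AlgHom.toLinearMap_apply, AlgHom.toLinearMap_apply,
      diffOp_rhoC, spreadInit_rhoC]

lemma coface_spread (m n : ℕ) (i : Fin n) (f : Pn k N m) :
    coface k N n i (spread k N m n f) = spread k N m (n + 1) f := by
  suffices (coface k N n i).comp (spread k N m n) = spread k N m (n + 1) from
    DFunLike.congr_fun this f
  ext1 a
  simp only [AlgHom.comp_apply, spread, aeval_X, map_sum, coface_X]
  rw [Finset.sum_comm]
  simp

lemma coface_comp_symb (m n : ℕ) (i : Fin n) (z : Pn k N m ⊗[k] Pn k N n) :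
    (coface k N n i).toLinearMap ∘ₗ symb k N m n z =
      symb k N m (n + 1) ((coface k N n i).toLinearMap.lTensor _ z) := by
  induction z using TensorProduct.induction_on with
  | zero => simp
  | add z z' h h' => simp only [map_add, LinearMap.comp_add, h, h']
  | tmul p q =>
    refine LinearMap.ext fun f => ?_
    rw [LinearMap.lTensor_tmul, LinearMap.comp_apply, symb_tmul, symb_tmul,
      AlgHom.toLinearMap_apply, map_mul, coface_spread, AlgHom.toLinearMap_apply]

/-- On symbols, the differential `d2` is the cobar differential of the second factor. -/
lemma d2_symb (m n : ℕ) (z : Pn k N m ⊗[k] Pn k N n) :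
    d2 k N m n (symb k N m n z) = symb k N m (n + 1) ((cobar k N n).lTensor _ z) := by
  simp only [d2, lextend_symb_comp_lam, rextend_symb_comp_rhoC, coface_comp_symb, cobar_eq,
    ← LinearMap.coe_lTensorHom, map_add, map_sum, map_smul, LinearMap.add_apply,
    LinearMap.sum_apply, LinearMap.smul_apply]

end Differentials

section Cohomology

variable {k N}

set_option linter.unusedSectionVars false

open scoped TensorProduct

lemma sum_coeff_altPlace_smul_linMon (n : ℕ) (b : Fin n → Fin N) :
    ∑ a, coeff (linExp b) (altPlace k N n (basisWedge k N n a)) • linMon k N n a =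
      altPlace k N n (basisWedge k N n b) := by
  simp only [altPlace_basisWedge, coeff_sum, coeff_smul, coeff_linMon, Finset.sum_smul]
  rw [Finset.sum_comm, ← Equiv.sum_comp (Equiv.inv (Equiv.Perm (Fin n)))]
  refine Finset.sum_congr rfl fun σ _ => ?_
  have h (a : Fin n → Fin N) : b = a ∘ ⇑σ⁻¹ ↔ a = b ∘ ⇑σ := by
    constructor
    · rintro rfl
      funext x
      simp
    · rintro rfl
      funext x
      simp
  rw [Finset.sum_eq_single (b ∘ ⇑σ)]
  · rw [Equiv.inv_apply, Equiv.Perm.sign_inv, if_pos ((h _).2 rfl)]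
    simp only [Units.smul_def, smul_assoc, one_smul]
  · intro a _ ha
    rw [Equiv.inv_apply, if_neg fun h' => ha ((h a).1 h'), smul_zero, zero_smul]
  · simp

lemma toWedge_sum_coeff_smul (n : ℕ) (b : Fin n → Fin N) :
    ∑ a, coeff (linExp b) (altPlace k N n (basisWedge k N n a)) •
      toWedge k N n (linMon k N n a) = basisWedge k N n b := by
  simp only [← map_smul, ← map_sum]
  rw [sum_coeff_altPlace_smul_linMon, toWedge_altPlace]

variable (k N) in
/-- The symbol of the first-order operator `F1 f`. -/
def symbF1 (m n : ℕ) : ((⋀[k]^m (W k N)) →ₗ[k] (⋀[k]^n (W k N))) →ₗ[k] Pn k N m ⊗[k] Pn k N n :=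
  ∑ a, TensorProduct.mk k _ _ (linMon k N m a) ∘ₗ altPlace k N n ∘ₗ
    LinearMap.applyₗ (basisWedge k N m a)

lemma symbF1_apply (m n : ℕ) (f : (⋀[k]^m (W k N)) →ₗ[k] (⋀[k]^n (W k N))) :
    symbF1 k N m n f = ∑ a, linMon k N m a ⊗ₜ altPlace k N n (f (basisWedge k N m a)) := by
  simp [symbF1]

lemma F1_eq_symb (m n : ℕ) (f : (⋀[k]^m (W k N)) →ₗ[k] (⋀[k]^n (W k N))) :
    F1 k N m n f = symb k N m n (symbF1 k N m n f) := by
  rw [symbF1_apply, map_sum, F1]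
  refine Finset.sum_congr rfl fun a _ => LinearMap.ext fun g => ?_
  have h : xMon k N m (fun s => [a s]) = linMon k N m a := by simp [xMon, linMon]
  rw [symb_tmul, derivOp_eq_diffOp, h]
  rfl

lemma exists_symbF1_eq (m n : ℕ) (z : Pn k N m ⊗[k] Pn k N n) :
    ∃ f, symbF1 k N m n f = TensorProduct.map (altProj k N m) (altProj k N n) z := by
  rw [← LinearMap.mem_range]
  induction z using TensorProduct.induction_on with
  | zero => rw [map_zero]; exact zero_mem _
  | add z z' h h' => rw [map_add]; exact add_mem h h'
  | tmul p q =>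
    refine ⟨LinearMap.smulRight ((m.factorial : k)⁻¹ • ∑ b : Fin m → Fin N,
      coeff (linExp b) p • (lcoeff k (linExp b) ∘ₗ altPlace k N m)) (toWedge k N n q), ?_⟩
    simp only [symbF1_apply, TensorProduct.map_tmul, LinearMap.smulRight_apply, map_smul,
      TensorProduct.tmul_smul, TensorProduct.smul_tmul', ← TensorProduct.sum_tmul,
      altProj, LinearMap.comp_apply, toWedge_apply _ p, map_sum, LinearMap.smul_apply,
      LinearMap.sum_apply, lcoeff_apply]
    congr 1
    have h : ∑ b, coeff (linExp b) p • altPlace k N m (basisWedge k N m b) =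
        ∑ b, coeff (linExp b) p • ∑ a,
          coeff (linExp b) (altPlace k N m (basisWedge k N m a)) • linMon k N m a :=
      Finset.sum_congr rfl fun b _ => by rw [sum_coeff_altPlace_smul_linMon]
    rw [h]
    simp only [Finset.smul_sum, Finset.mul_sum, Finset.sum_smul, smul_smul, smul_eq_mul]
    exact Finset.sum_comm

lemma eq_zero_of_symbF1_eq (m n : ℕ)
    (f : (⋀[k]^(m + 1) (W k N)) →ₗ[k] (⋀[k]^(n + 1) (W k N)))
    (u : Pn k N m ⊗[k] Pn k N (n + 1)) (v : Pn k N (m + 1) ⊗[k] Pn k N n)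
    (h : symbF1 k N (m + 1) (n + 1) f = (cobar k N m).rTensor _ u + (cobar k N n).lTensor _ v) :
    f = 0 := by
  refine hom_ext_basisWedge fun b => ?_
  let e := (TensorProduct.lid k _).toLinearMap ∘ₗ TensorProduct.map
    (lcoeff k (linExp b) ∘ₗ altPlace k N (m + 1) ∘ₗ toWedge k N (m + 1)) (toWedge k N (n + 1))
  have hu : e ∘ₗ (cobar k N m).rTensor _ = 0 := by
    ext1
    refine LinearMap.ext fun p => LinearMap.ext fun q => ?_
    simp [e, toWedge_cobar]
  have hv : e ∘ₗ (cobar k N n).lTensor _ = 0 := by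
    refine TensorProduct.ext' fun p q => ?_
    simp [e, toWedge_cobar]
  have hf : e (symbF1 k N (m + 1) (n + 1) f) = f (basisWedge k N (m + 1) b) := by
    rw [← toWedge_sum_coeff_smul, symbF1_apply]
    simp only [map_sum, map_smul, e, LinearMap.comp_apply, TensorProduct.map_tmul,
      LinearEquiv.coe_coe, TensorProduct.lid_tmul, toWedge_altPlace, toWedge_linMon,
      lcoeff_apply, smul_smul, mul_comm, smul_eq_mul]
  rw [← hf, h, map_add, LinearMap.zero_apply]
  exact (congrArg₂ _ (LinearMap.congr_fun hu u) (LinearMap.congr_fun hv v)).trans (add_zero _)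

end Cohomology

/-- Corollary 4.9 of the paper: the bialgebra analogue of the
Kostant–Hochschild–Rosenberg theorem. For every `m, n ≥ 1` (written `m = m'+1`, `n = n'+1`)
and every `d_gs`-cocycle `Γ` in the polydifferential Gerstenhaber–Schack complex of `B` in
bidegree `(m, n)`, there are a unique `f ∈ Hom_k(Λ^m W, Λ^n W)` and elements
`Γ' ∈ Hom_poly(B^{⊗(m-1)}, B^{⊗n})` (taken to be `0` if `m = 1`) and
`Γ'' ∈ Hom_poly(B^{⊗m}, B^{⊗(n-1)})` (taken to be `0` if `n = 1`) with
`Γ = F₁(f) + d₁Γ' + d₂Γ''`; i.e. the cohomology in bidegree `(m,n)` is `Hom_k(Λ^m W, Λ^n W)`. -/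
theorem gs_poly_cohomology (m' n' : ℕ)
    (Γ : Pn k N (m' + 1) →ₗ[k] Pn k N (n' + 1))
    (hΓ : Γ ∈ polyHom k N (m' + 1) (n' + 1))
    (hc1 : d1 k N (m' + 1) (n' + 1) Γ = 0)
    (hc2 : d2 k N (m' + 1) (n' + 1) Γ = 0) :
    ∃! f : (⋀[k]^(m' + 1) (W k N)) →ₗ[k] (⋀[k]^(n' + 1) (W k N)),
      ∃ (Γ' : Pn k N m' →ₗ[k] Pn k N (n' + 1)) (Γ'' : Pn k N (m' + 1) →ₗ[k] Pn k N n'),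
        Γ' ∈ polyHom k N m' (n' + 1) ∧
        Γ'' ∈ polyHom k N (m' + 1) n' ∧
        (m' = 0 → Γ' = 0) ∧
        (n' = 0 → Γ'' = 0) ∧
        Γ = F1 k N (m' + 1) (n' + 1) f + d1 k N m' (n' + 1) Γ' + d2 k N (m' + 1) n' Γ'' := by
  simp only [polyHom_eq_range_symb] at hΓ ⊢
  obtain ⟨z, rfl⟩ := hΓ
  have hz1 : (cobar k N (m' + 1)).rTensor _ z = 0 :=
    symb_injective _ _ (by rw [← d1_symb, hc1, map_zero])
  have hz2 : (cobar k N (n' + 1)).lTensor _ z = 0 :=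
    symb_injective _ _ (by rw [← d2_symb, hc2, map_zero])
  refine existsUnique_of_exists_of_unique ?_ ?_
  · obtain ⟨s, g, hs, hsg⟩ := exists_cobar_homotopy (k := k) (N := N) m'
    obtain ⟨s', g', hs', hsg'⟩ := exists_cobar_homotopy (k := k) (N := N) n'
    obtain ⟨f, hf⟩ := exists_symbF1_eq (m' + 1) (n' + 1) z
    have hid : (LinearMap.id : Pn k N (m' + 1) →ₗ[k] _) =
        altProj k N (m' + 1) + cobar k N m' ∘ₗ s + g ∘ₗ cobar k N (m' + 1) :=
      LinearMap.ext hsg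
    have hid' : (LinearMap.id : Pn k N (n' + 1) →ₗ[k] _) =
        altProj k N (n' + 1) + cobar k N n' ∘ₗ s' + g' ∘ₗ cobar k N (n' + 1) :=
      LinearMap.ext hsg'
    have h1 : z = (altProj k N (m' + 1)).rTensor _ z +
        (cobar k N m').rTensor _ (s.rTensor _ z) := by
      have := congrArg (fun t => LinearMap.rTensor (Pn k N (n' + 1)) t z) hid
      simpa [LinearMap.rTensor_add, LinearMap.rTensor_comp, hz1] using this
    have h2 : z = (altProj k N (n' + 1)).lTensor _ z +
        (cobar k N n').lTensor _ (s'.lTensor _ z) := by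
      have := congrArg (fun t => LinearMap.lTensor (Pn k N (m' + 1)) t z) hid'
      simpa [LinearMap.lTensor_add, LinearMap.lTensor_comp, hz2] using this
    have hcomm : (altProj k N (m' + 1)).rTensor _ z = TensorProduct.map (altProj k N (m' + 1))
        (altProj k N (n' + 1)) z + (cobar k N n').lTensor _
          (TensorProduct.map (altProj k N (m' + 1)) s' z) := by
      conv_lhs => rw [h2]
      rw [map_add]
      simp only [← LinearMap.comp_apply, LinearMap.rTensor_comp_lTensor,
        LinearMap.lTensor_comp_map, ← LinearMap.lTensor_comp]
    refine ⟨f, symb k N _ _ (s.rTensor _ z),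
      symb k N _ _ (TensorProduct.map (altProj k N (m' + 1)) s' z), ⟨_, rfl⟩, ⟨_, rfl⟩, ?_, ?_, ?_⟩
    · intro h
      rw [hs h, LinearMap.rTensor_zero, LinearMap.zero_apply, map_zero]
    · intro h
      rw [hs' h, TensorProduct.map_zero_right, LinearMap.zero_apply, map_zero]
    · rw [F1_eq_symb, d1_symb, d2_symb, hf, ← map_add, ← map_add]
      conv_lhs => rw [h1, hcomm]
      rw [add_right_comm]
  · rintro f₁ f₂ ⟨_, _, ⟨u₁, rfl⟩, ⟨v₁, rfl⟩, -, -, h₁⟩ ⟨_, _, ⟨u₂, rfl⟩, ⟨v₂, rfl⟩, -, -, h₂⟩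
    rw [F1_eq_symb, d1_symb, d2_symb, ← map_add, ← map_add] at h₁ h₂
    have h := (symb_injective _ _ h₁).symm.trans (symb_injective _ _ h₂)
    refine sub_eq_zero.1 (eq_zero_of_symbF1_eq m' n' (f₁ - f₂) (u₂ - u₁) (v₂ - v₁) ?_)
    have hf : symbF1 k N (m' + 1) (n' + 1) (f₁ - f₂) + symbF1 k N (m' + 1) (n' + 1) f₂ =
        symbF1 k N (m' + 1) (n' + 1) f₁ := by
      rw [← map_add]
      exact congrArg _ (sub_add_cancel f₁ f₂)
    rw [eq_sub_of_add_eq hf, map_sub, map_sub, sub_add_sub_comm,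
      sub_eq_sub_iff_add_eq_add, ← add_assoc, h]
    abel

end GS
end
end

section
/- {γ_μ, γ_μ} = 0 in A if and only if μ satisfies the Jacobi identity: [a,[b,c]] = [[a,b],c] + [b,[a,c]] for all a, b, c ∈ V. -/
noncomputable section

open TensorProduct

namespace BigBracket

variable (k : Type) [Field k] [CharZero k]
variable (V : Type) [AddCommGroup V] [Module k V] [FiniteDimensional k V]

/-- The exterior algebra `A = Λ(V ⊕ V*)`, graded by exterior degree. -/
abbrev A : Type := ExteriorAlgebra k (V × Module.Dual k V)

/-- The canonical degree-one inclusion of `V` into `A`. -/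
def ιV : V →ₗ[k] A k V :=
  (ExteriorAlgebra.ι k).comp (LinearMap.inl k V (Module.Dual k V))

/-- The canonical degree-one inclusion of `V*` into `A`. -/
def ιD : Module.Dual k V →ₗ[k] A k V :=
  (ExteriorAlgebra.ι k).comp (LinearMap.inr k V (Module.Dual k V))

/-- The degree-`p` homogeneous component `A^p` of `A = Λ(V ⊕ V*)`. -/
def deg (p : ℕ) : Submodule k (A k V) :=
  (LinearMap.range (ExteriorAlgebra.ι k : (V × Module.Dual k V) →ₗ[k] A k V)) ^ p

/-- The defining properties (a)–(d) of the big bracket `{·,·} : A × A → A`: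
(a) `{A^p, A^q} ⊆ A^{p+q-2}`;
(b) `{v,w} = 0`, `{α,β} = 0`, `{α,v} = {v,α} = ⟨α,v⟩` for `v,w ∈ V`, `α,β ∈ V*`, and
    `{1,a} = 0`;
(c) for homogeneous `a ∈ A^p`, the map `{a,·}` is a graded derivation:
    `{a, b∧c} = {a,b}∧c + (-1)^{(p-2)q} b∧{a,c}` for homogeneous `b ∈ A^q` and all `c`;
(d) graded antisymmetry `{a,b} = -(-1)^{(p-2)(q-2)} {b,a}`. -/
structure IsBigBracket (br : A k V →ₗ[k] A k V →ₗ[k] A k V) : Prop where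
  mem_deg : ∀ (p q : ℕ) (a b : A k V), a ∈ deg k V p → b ∈ deg k V q →
    br a b ∈ deg k V (p + q - 2)
  ιV_ιV : ∀ v w : V, br (ιV k V v) (ιV k V w) = 0
  ιD_ιD : ∀ α β : Module.Dual k V, br (ιD k V α) (ιD k V β) = 0
  ιD_ιV : ∀ (α : Module.Dual k V) (v : V),
    br (ιD k V α) (ιV k V v) = algebraMap k (A k V) (α v)
  ιV_ιD : ∀ (v : V) (α : Module.Dual k V),
    br (ιV k V v) (ιD k V α) = algebraMap k (A k V) (α v)
  one_left : ∀ a : A k V, br 1 a = 0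
  derivation : ∀ (p : ℕ) (a : A k V), a ∈ deg k V p → ∀ (q : ℕ) (b : A k V), b ∈ deg k V q →
    ∀ c : A k V,
      br a (b * c) = br a b * c + ((-1 : k) ^ (((p : ℤ) - 2) * (q : ℤ))) • (b * br a c)
  antisymm : ∀ (p : ℕ) (a : A k V), a ∈ deg k V p → ∀ (q : ℕ) (b : A k V), b ∈ deg k V q →
    br a b = -(((-1 : k) ^ (((p : ℤ) - 2) * ((q : ℤ) - 2))) • br b a)

/-- The subspace `Λ²V* ∧ V ⊆ A³`, spanned by the products `α∧β∧v`. -/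
def muSpan : Submodule k (A k V) :=
  Submodule.span k
    {x | ∃ (α β : Module.Dual k V) (v : V), x = ιD k V α * ιD k V β * ιV k V v}

/-- The subspace `V* ∧ Λ²V ⊆ A³`, spanned by the products `α∧u∧w`. -/
def deltaSpan : Submodule k (A k V) :=
  Submodule.span k
    {x | ∃ (α : Module.Dual k V) (u w : V), x = ιD k V α * ιV k V u * ιV k V w}

/-- `γμ ∈ A³` is the element corresponding to the (antisymmetric bilinear encoding `br2` of
the) linear map `μ : Λ²V → V` via the canonical isomorphism `Hom(Λ²V, V) ≅ Λ²V* ⊗ V` and the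
embedding `(α∧β)⊗v ↦ α∧β∧v`: equivalently, `γμ` lies in the span of the products `α∧β∧v` and
satisfies `{b, {a, γμ}} = [a,b]` for all `a, b ∈ V` (here `[a,b] = μ(a∧b) = br2 a b`). -/
def RepresentsBracket (br : A k V →ₗ[k] A k V →ₗ[k] A k V)
    (br2 : V →ₗ[k] V →ₗ[k] V) (γμ : A k V) : Prop :=
  γμ ∈ muSpan k V ∧
    ∀ a b : V, br (ιV k V b) (br (ιV k V a) γμ) = ιV k V (br2 a b)

/-- `γδ ∈ A³` is the element corresponding to the linear map `δ : V → Λ²V` (encoded as an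
antisymmetric map `δ : V → V⊗V` via `u∧w ↦ u⊗w - w⊗u`) via the canonical isomorphism
`Hom(V, Λ²V) ≅ V* ⊗ Λ²V` and the embedding `α⊗(u∧w) ↦ α∧u∧w`: equivalently, `γδ` lies in the
span of the products `α∧u∧w` and satisfies `{a, γδ} = δ(a)` in `Λ²V ⊂ A²` for all `a ∈ V`
(the factor `2` accounts for the encoding `u∧w ↦ u⊗w - w⊗u`, since `u∧w` maps to
`(1/2)(ι(u)ι(w) - ι(w)ι(u))` under it). -/
def RepresentsCobracket (br : A k V →ₗ[k] A k V →ₗ[k] A k V)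
    (δ : V →ₗ[k] V ⊗[k] V) (γδ : A k V) : Prop :=
  γδ ∈ deltaSpan k V ∧
    ∀ a : V,
      (LinearMap.mul' k (A k V)) ((TensorProduct.map (ιV k V) (ιV k V)) (δ a))
        = (2 : k) • br (ιV k V a) γδ

/-- The Jacobi identity `[a,[b,c]] = [[a,b],c] + [b,[a,c]]`. -/
def LieJacobi (br2 : V →ₗ[k] V →ₗ[k] V) : Prop :=
  ∀ a b c : V, br2 a (br2 b c) = br2 (br2 a b) c + br2 b (br2 a c)

/-- A cyclic permutation `τ` of `V⊗V⊗V`. -/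
def cyc : (V ⊗[k] V) ⊗[k] V ≃ₗ[k] (V ⊗[k] V) ⊗[k] V :=
  (TensorProduct.assoc k V V V).trans (TensorProduct.comm k V (V ⊗[k] V))

/-- The co-Jacobi identity `(δ⊗id)δ(a) + τ((δ⊗id)δ(a)) + τ²((δ⊗id)δ(a)) = 0` in `V⊗V⊗V`
(being a sum over the cyclic group, this is independent of the choice of generator `τ`). -/
def CoJacobi (δ : V →ₗ[k] V ⊗[k] V) : Prop :=
  ∀ a : V,
    (LinearMap.rTensor V δ) (δ a) + cyc k V ((LinearMap.rTensor V δ) (δ a))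
      + cyc k V (cyc k V ((LinearMap.rTensor V δ) (δ a))) = 0

/-- The encoding `Λ²V → V⊗V`, `x∧y ↦ x⊗y - y⊗x`, applied to a decomposable element `x⊗y`. -/
def wedgeify : V ⊗[k] V →ₗ[k] V ⊗[k] V :=
  LinearMap.id - (TensorProduct.comm k V V).toLinearMap

/-- The Leibniz-type compatibility identity (condition (iii) of §2.1 of the paper):
`δ([a,b]) = Σ a₍₁₎∧[a₍₂₎,b] - Σ a₍₂₎∧[a₍₁₎,b] + Σ [a,b₍₁₎]∧b₍₂₎ - Σ [a,b₍₂₎]∧b₍₁₎` in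
`Λ²V ⊂ V⊗V`, where `δ(a) = Σ a₍₁₎ ⊗ a₍₂₎` and `x∧y` is encoded as `x⊗y - y⊗x`. -/
def Compat (br2 : V →ₗ[k] V →ₗ[k] V) (δ : V →ₗ[k] V ⊗[k] V) : Prop :=
  ∀ a b : V,
    δ (br2 a b) =
      wedgeify k V ((LinearMap.lTensor V (br2.flip b)) (δ a))
        - wedgeify k V ((LinearMap.lTensor V (br2.flip b)) ((TensorProduct.comm k V V) (δ a)))
        + wedgeify k V ((LinearMap.rTensor V (br2 a)) (δ b))
        - wedgeify k V ((LinearMap.rTensor V (br2 a)) ((TensorProduct.comm k V V) (δ b)))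

section DegreeOne

variable {k V}
omit [CharZero k] [FiniteDimensional k V]

variable {br : A k V →ₗ[k] A k V →ₗ[k] A k V}

lemma ι_eq_add (m : V × Module.Dual k V) :
    ExteriorAlgebra.ι k m = ιV k V m.1 + ιD k V m.2 := by
  simp [ιV, ιD, ← map_add]

lemma ιV_injective : Function.Injective (ιV k V) := by
  intro v w h
  have hι := (ExteriorAlgebra.ι_leftInverse (R := k) (M := V × Module.Dual k V)).injective h
  simpa using hι

lemma ι_mem_deg (m : V × Module.Dual k V) : ExteriorAlgebra.ι k m ∈ deg k V 1 := by
  simp [deg]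

lemma ιV_mem_deg (v : V) : ιV k V v ∈ deg k V 1 := ι_mem_deg _

lemma ιD_mem_deg (α : Module.Dual k V) : ιD k V α ∈ deg k V 1 := ι_mem_deg _

lemma muSpan_le_deg : muSpan k V ≤ deg k V 3 := by
  refine Submodule.span_le.2 ?_
  rintro _ ⟨α, β, v, rfl⟩
  have h : deg k V 3 = deg k V 1 * deg k V 1 * deg k V 1 := by
    simp only [deg, pow_succ, pow_zero, one_mul]
  rw [h]
  exact Submodule.mul_mem_mul (Submodule.mul_mem_mul (ιD_mem_deg α) (ιD_mem_deg β)) (ιV_mem_deg v)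

lemma ι_mul_ι_anticomm (m n : V × Module.Dual k V) :
    ExteriorAlgebra.ι k m * ExteriorAlgebra.ι k n
      = -(ExteriorAlgebra.ι k n * ExteriorAlgebra.ι k m) :=
  eq_neg_of_add_eq_zero_left (ExteriorAlgebra.ι_add_mul_swap m n)

lemma neg_one_zpow_natCast_sub_two (p : ℕ) : (-1 : k) ^ ((p : ℤ) - 2) = (-1) ^ p := by
  rw [zpow_sub₀ (by simp)]
  simp

namespace IsBigBracket

variable (hbr : IsBigBracket k V br)

include hbr

lemma ι_ι (m n : V × Module.Dual k V) :
    br (ExteriorAlgebra.ι k m) (ExteriorAlgebra.ι k n)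
      = algebraMap k (A k V) (m.2 n.1 + n.2 m.1) := by
  rw [ι_eq_add, ι_eq_add]
  simp [hbr.ιV_ιV, hbr.ιD_ιD, hbr.ιD_ιV, hbr.ιV_ιD, add_comm]

lemma apply_ι_mul {p : ℕ} {x : A k V} (hx : x ∈ deg k V p) (m : V × Module.Dual k V)
    (y : A k V) :
    br x (ExteriorAlgebra.ι k m * y)
      = br x (ExteriorAlgebra.ι k m) * y
        + (-1 : k) ^ p • (ExteriorAlgebra.ι k m * br x y) := by
  rw [hbr.derivation p x hx 1 _ (ι_mem_deg m) y]
  simp [neg_one_zpow_natCast_sub_two]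

lemma ι_apply_mul {p : ℕ} {x : A k V} (hx : x ∈ deg k V p) (m : V × Module.Dual k V)
    (y : A k V) :
    br (ExteriorAlgebra.ι k m) (x * y)
      = br (ExteriorAlgebra.ι k m) x * y
        + (-1 : k) ^ p • (x * br (ExteriorAlgebra.ι k m) y) := by
  rw [hbr.derivation 1 _ (ι_mem_deg m) p x hx y]
  have h : (((1 : ℕ) : ℤ) - 2) * (p : ℤ) = -(p : ℤ) := by push_cast; ring
  rw [h, zpow_neg, zpow_natCast, ← inv_pow, inv_neg_one]

lemma ι_apply_ι_mul (m n : V × Module.Dual k V) (y : A k V) :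
    br (ExteriorAlgebra.ι k m) (ExteriorAlgebra.ι k n * y)
      = (m.2 n.1 + n.2 m.1) • y
        - ExteriorAlgebra.ι k n * br (ExteriorAlgebra.ι k m) y := by
  rw [hbr.ι_apply_mul (ι_mem_deg n), hbr.ι_ι, ← Algebra.smul_def]
  simp [sub_eq_add_neg]

lemma apply_ι {p : ℕ} {x : A k V} (hx : x ∈ deg k V p) (m : V × Module.Dual k V) :
    br x (ExteriorAlgebra.ι k m) = -((-1 : k) ^ p • br (ExteriorAlgebra.ι k m) x) := by
  rw [hbr.antisymm p x hx 1 _ (ι_mem_deg m)]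
  have h : ((p : ℤ) - 2) * (((1 : ℕ) : ℤ) - 2) = -((p : ℤ) - 2) := by push_cast; ring
  rw [h, zpow_neg, neg_one_zpow_natCast_sub_two, ← inv_pow, inv_neg_one]

lemma apply_one {p : ℕ} {x : A k V} (hx : x ∈ deg k V p) : br x 1 = 0 := by
  have h := hbr.derivation p x hx 0 1 (by simp [deg]) 1
  simpa using h

lemma apply_algebraMap {p : ℕ} {x : A k V} (hx : x ∈ deg k V p) (r : k) :
    br x (algebraMap k (A k V) r) = 0 := by
  rw [Algebra.algebraMap_eq_smul_one, map_smul, hbr.apply_one hx, smul_zero]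

/-- Brackets with degree-one elements anticommute. -/
lemma ι_apply_ι_apply_anticomm (m n : V × Module.Dual k V) (x : A k V) :
    br (ExteriorAlgebra.ι k m) (br (ExteriorAlgebra.ι k n) x)
      = -br (ExteriorAlgebra.ι k n) (br (ExteriorAlgebra.ι k m) x) := by
  induction x using CliffordAlgebra.left_induction with
  | algebraMap r =>
    have h (l : V × Module.Dual k V) := hbr.apply_algebraMap (ι_mem_deg l) r
    simp only [ExteriorAlgebra] at h ⊢
    simp [h]
  | add x y hx hy => simp only [map_add, hx, hy, neg_add]
  | ι_mul x u hx =>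
    change br (ExteriorAlgebra.ι k m) (br (ExteriorAlgebra.ι k n) (ExteriorAlgebra.ι k u * x))
      = -br (ExteriorAlgebra.ι k n) (br (ExteriorAlgebra.ι k m) (ExteriorAlgebra.ι k u * x))
    simp only [hbr.ι_apply_ι_mul, map_sub, map_smul, hx, mul_neg]
    abel

/-- The graded Jacobi identity of the big bracket with one entry of degree one. -/
lemma ι_apply_apply {p : ℕ} {x : A k V} (hx : x ∈ deg k V (p + 1)) (m : V × Module.Dual k V)
    (y : A k V) :
    br (ExteriorAlgebra.ι k m) (br x y)
      = br (br (ExteriorAlgebra.ι k m) x) y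
        + (-1 : k) ^ (p + 1) • br x (br (ExteriorAlgebra.ι k m) y) := by
  have hmx : br (ExteriorAlgebra.ι k m) x ∈ deg k V p := by
    have h := hbr.mem_deg 1 (p + 1) _ _ (ι_mem_deg m) hx
    rwa [show 1 + (p + 1) - 2 = p by omega] at h
  induction y using CliffordAlgebra.left_induction with
  | algebraMap r =>
    have h1 := hbr.apply_algebraMap hx r
    have h2 := hbr.apply_algebraMap hmx r
    have h3 := hbr.apply_algebraMap (ι_mem_deg m) r
    simp only [ExteriorAlgebra] at h1 h2 h3 ⊢
    simp [h1, h2, h3]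
  | add y z hy hz =>
    simp only [map_add, hy, hz, smul_add]
    abel
  | ι_mul y u hy =>
    change br (ExteriorAlgebra.ι k m) (br x (ExteriorAlgebra.ι k u * y))
      = br (br (ExteriorAlgebra.ι k m) x) (ExteriorAlgebra.ι k u * y)
        + (-1 : k) ^ (p + 1) • br x (br (ExteriorAlgebra.ι k m) (ExteriorAlgebra.ι k u * y))
    have hxu : br x (ExteriorAlgebra.ι k u) ∈ deg k V p :=
      hbr.mem_deg (p + 1) 1 _ _ hx (ι_mem_deg u)
    have hgen : br (ExteriorAlgebra.ι k m) (br x (ExteriorAlgebra.ι k u))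
        = br (br (ExteriorAlgebra.ι k m) x) (ExteriorAlgebra.ι k u) := by
      rw [hbr.apply_ι hx, hbr.apply_ι hmx, map_neg, map_smul,
        hbr.ι_apply_ι_apply_anticomm m u, pow_succ]
      simp
    rw [hbr.apply_ι_mul hx, map_add, map_smul, hbr.ι_apply_mul hxu, hgen, hbr.ι_apply_ι_mul,
      hbr.apply_ι_mul hmx, hbr.ι_apply_ι_mul, map_sub, map_smul, hbr.apply_ι_mul hx, hy]
    simp only [smul_add, smul_sub, mul_add, mul_smul_comm, smul_smul, pow_succ, mul_neg, neg_mul,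
      mul_one, neg_smul]
    abel

/-- The triple bracket of `{γ, γ}` with elements of `V` is twice the Jacobiator. -/
lemma ιV_apply_ιV_apply_ιV_apply_sq {br2 : V →ₗ[k] V →ₗ[k] V} {γ : A k V}
    (hγ : RepresentsBracket k V br br2 γ) (a b c : V) :
    br (ιV k V c) (br (ιV k V b) (br (ιV k V a) (br γ γ)))
      = ιV k V ((2 : k) • (br2 (br2 a b) c + br2 b (br2 a c) - br2 a (br2 b c))) := by
  have hγdeg := muSpan_le_deg hγ.1
  have hdeg (v : V) : br (ιV k V v) γ ∈ deg k V 2 := hbr.mem_deg 1 3 _ _ (ιV_mem_deg v) hγdeg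
  have jacobi {p : ℕ} {x : A k V} (hx : x ∈ deg k V (p + 1)) (v : V) (y : A k V) :
      br (ιV k V v) (br x y)
        = br (br (ιV k V v) x) y + (-1 : k) ^ (p + 1) • br x (br (ιV k V v) y) :=
    hbr.ι_apply_apply hx _ y
  have h1 : br (ιV k V a) (br γ γ) = (2 : k) • br (br (ιV k V a) γ) γ := by
    have h := hbr.antisymm 3 γ hγdeg 2 _ (hdeg a)
    rw [jacobi hγdeg, h]
    norm_num [two_smul, Odd.neg_one_pow]
  have h2 : br (br (ιV k V a) γ) (ιV k V (br2 b c)) = -ιV k V (br2 a (br2 b c)) := by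
    rw [← hγ.2 a (br2 b c)]
    refine (hbr.apply_ι (hdeg a) _).trans ?_
    norm_num [ιV]
  rw [h1, map_smul, map_smul, jacobi (hdeg a), map_add, map_smul, hγ.2, hγ.2, jacobi (hdeg a),
    hγ.2, hγ.2, hγ.2, h2]
  simp only [map_smul, map_add, map_sub]
  norm_num [smul_sub, smul_add]
  abel

end IsBigBracket

end DegreeOne

section Euler

variable {k V}
variable {br : A k V →ₗ[k] A k V →ₗ[k] A k V}
omit [CharZero k]

variable (br) in
/-- The operator `∑ᵢ eⁱ ∧ {eᵢ, ·}` for dual bases `eᵢ`, `eⁱ` of `V` and `V*`. It counts the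
number of factors from `V*`. -/
def euler : A k V →ₗ[k] A k V :=
  ∑ i, LinearMap.mulLeft k (ιD k V ((Module.finBasis k V).coord i)) ∘ₗ
    br (ιV k V (Module.finBasis k V i))

lemma euler_apply (x : A k V) :
    euler br x = ∑ i, ιD k V ((Module.finBasis k V).coord i) *
      br (ιV k V (Module.finBasis k V i)) x := by
  simp [euler]

lemma eq_zero_of_euler_eq {x : A k V} {r : k} (hr : r ≠ 0) (hx : euler br x = r • x)
    (h : ∀ a : V, br (ιV k V a) x = 0) : x = 0 := by
  have h0 : euler br x = 0 := by simp [euler_apply, h]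
  rw [h0] at hx
  exact (smul_eq_zero.1 hx.symm).resolve_left hr

namespace IsBigBracket

variable (hbr : IsBigBracket k V br)

include hbr

lemma euler_algebraMap (r : k) : euler br (algebraMap k (A k V) r) = 0 := by
  rw [euler_apply]
  exact Finset.sum_eq_zero fun i _ => by rw [hbr.apply_algebraMap (ιV_mem_deg _), mul_zero]

lemma euler_ιV (v : V) : euler br (ιV k V v) = 0 := by
  simp [euler_apply, hbr.ιV_ιV]

lemma euler_ιD (α : Module.Dual k V) : euler br (ιD k V α) = ιD k V α := by
  conv_rhs => rw [← (Module.finBasis k V).sum_dual_apply_smul_coord α]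
  rw [euler_apply, map_sum]
  refine Finset.sum_congr rfl fun i _ => ?_
  rw [hbr.ιV_ιD, map_smul, ← Algebra.commutes, ← Algebra.smul_def]

lemma euler_ι_mul (m : V × Module.Dual k V) (x : A k V) :
    euler br (ExteriorAlgebra.ι k m * x)
      = euler br (ExteriorAlgebra.ι k m) * x + ExteriorAlgebra.ι k m * euler br x := by
  simp only [euler_apply, Finset.sum_mul, Finset.mul_sum, ← Finset.sum_add_distrib]
  refine Finset.sum_congr rfl fun i _ => ?_
  simp only [ιV, ιD, LinearMap.comp_apply]
  rw [hbr.ι_apply_mul (ι_mem_deg m)]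
  simp only [pow_one, neg_smul, one_smul, mul_add, mul_neg, ← mul_assoc]
  rw [ι_mul_ι_anticomm m, neg_mul]

lemma euler_mul (x y : A k V) : euler br (x * y) = euler br x * y + x * euler br y := by
  induction x using CliffordAlgebra.left_induction with
  | algebraMap r =>
    change euler br (algebraMap k (A k V) r * y)
      = euler br (algebraMap k (A k V) r) * y + algebraMap k (A k V) r * euler br y
    rw [hbr.euler_algebraMap, ← Algebra.smul_def, ← Algebra.smul_def, map_smul, zero_mul, zero_add]
  | add x z hx hz =>
    simp only [add_mul, map_add, hx, hz]
    abel
  | ι_mul x u hx =>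
    change euler br (ExteriorAlgebra.ι k u * x * y)
      = euler br (ExteriorAlgebra.ι k u * x) * y + ExteriorAlgebra.ι k u * x * euler br y
    rw [mul_assoc, hbr.euler_ι_mul, hbr.euler_ι_mul, hx]
    simp only [mul_add, add_mul, mul_assoc, add_assoc]

lemma euler_mul_of_eq {x y : A k V} {r s : k} (hx : euler br x = r • x)
    (hy : euler br y = s • y) : euler br (x * y) = (r + s) • (x * y) := by
  rw [hbr.euler_mul, hx, hy, smul_mul_assoc, mul_smul_comm, add_smul]

lemma euler_ιV_apply {x : A k V} {r : k} (hx : euler br x = r • x) (a : V) :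
    euler br (br (ιV k V a) x) = (r - 1) • br (ιV k V a) x := by
  have h : br (ιV k V a) (euler br x) = br (ιV k V a) x + euler br (br (ιV k V a) x) := by
    conv_rhs => enter [1]; rw [← (Module.finBasis k V).sum_repr a]
    rw [euler_apply, euler_apply, map_sum, map_sum, map_sum, LinearMap.sum_apply,
      ← Finset.sum_add_distrib]
    refine Finset.sum_congr rfl fun i _ => ?_
    rw [map_smul, map_smul, LinearMap.smul_apply]
    simp only [ιV, ιD, LinearMap.comp_apply]
    rw [hbr.ι_apply_ι_mul, hbr.ι_apply_ι_apply_anticomm]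
    simp
  rw [sub_smul, one_smul, ← map_smul, ← hx, h]
  abel

lemma euler_ιD_apply {x : A k V} {r : k} (hx : euler br x = r • x) (α : Module.Dual k V) :
    euler br (br (ιD k V α) x) = r • br (ιD k V α) x := by
  rw [← map_smul, ← hx, euler_apply, euler_apply, map_sum]
  refine Finset.sum_congr rfl fun i _ => ?_
  have hpair : br (ιD k V α) (ιD k V ((Module.finBasis k V).coord i)) = 0 := hbr.ιD_ιD _ _
  simp only [ιV, ιD, LinearMap.comp_apply] at hpair ⊢
  rw [hbr.ι_apply_mul (ι_mem_deg _), hpair, hbr.ι_apply_ι_apply_anticomm]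
  simp

lemma euler_of_mem_muSpan {x : A k V} (hx : x ∈ muSpan k V) : euler br x = (2 : k) • x := by
  induction hx using Submodule.span_induction with
  | mem x hx =>
    obtain ⟨α, β, v, rfl⟩ := hx
    have hD (ξ : Module.Dual k V) : euler br (ιD k V ξ) = (1 : k) • ιD k V ξ := by
      rw [hbr.euler_ιD, one_smul]
    have hV : euler br (ιV k V v) = (0 : k) • ιV k V v := by rw [hbr.euler_ιV, zero_smul]
    rw [hbr.euler_mul_of_eq (hbr.euler_mul_of_eq (hD α) (hD β)) hV]
    norm_num
  | zero => simp
  | add x y _ _ hx hy => rw [map_add, hx, hy, smul_add]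
  | smul r x _ hx => rw [map_smul, hx, smul_comm]

lemma euler_apply_of_mem_muSpan {x y : A k V} (hx : x ∈ muSpan k V) (hy : y ∈ muSpan k V) :
    euler br (br x y) = (3 : k) • br x y := by
  have hxdeg := muSpan_le_deg hx
  have hxe := hbr.euler_of_mem_muSpan hx
  induction hy using Submodule.span_induction with
  | mem y hy =>
    obtain ⟨α, β, v, rfl⟩ := hy
    have hD (ξ : Module.Dual k V) : euler br (ιD k V ξ) = (1 : k) • ιD k V ξ := by
      rw [hbr.euler_ιD, one_smul]
    have hV : euler br (ιV k V v) = (0 : k) • ιV k V v := by rw [hbr.euler_ιV, zero_smul]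
    have hxD (ξ : Module.Dual k V) : euler br (br x (ιD k V ξ)) = (2 : k) • br x (ιD k V ξ) := by
      have h : br x (ιD k V ξ) = br (ιD k V ξ) x := by
        refine (hbr.apply_ι hxdeg _).trans ?_
        norm_num [ιD]
      rw [h, hbr.euler_ιD_apply hxe]
    have hxV : euler br (br x (ιV k V v)) = (1 : k) • br x (ιV k V v) := by
      have h : br x (ιV k V v) = br (ιV k V v) x := by
        refine (hbr.apply_ι hxdeg _).trans ?_
        norm_num [ιV]
      rw [h, hbr.euler_ιV_apply hxe]
      norm_num
    have hexp : br x (ιD k V α * ιD k V β * ιV k V v)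
        = br x (ιD k V α) * (ιD k V β * ιV k V v)
          - ιD k V α * (br x (ιD k V β) * ιV k V v)
          + ιD k V α * (ιD k V β * br x (ιV k V v)) := by
      simp only [ιV, ιD, LinearMap.comp_apply, mul_assoc]
      rw [hbr.apply_ι_mul hxdeg, hbr.apply_ι_mul hxdeg]
      norm_num [mul_add, mul_sub, Odd.neg_one_pow]
      abel
    rw [hexp, map_add, map_sub,
      hbr.euler_mul_of_eq (hxD α) (hbr.euler_mul_of_eq (hD β) hV),
      hbr.euler_mul_of_eq (hD α) (hbr.euler_mul_of_eq (hxD β) hV),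
      hbr.euler_mul_of_eq (hD α) (hbr.euler_mul_of_eq (hD β) hxV)]
    norm_num [smul_add, smul_sub]
  | zero => simp
  | add y z _ _ hy hz => rw [map_add, map_add, hy, hz, smul_add]
  | smul r y _ hy => rw [map_smul, map_smul, hy, smul_comm]

end IsBigBracket

end Euler

/-- Let `{·,·}` be the big bracket on `A = Λ(V ⊕ V*)` and let
`μ : Λ²V → V` (encoded as the antisymmetric bilinear bracket `br2`, `[a,b] = μ(a∧b)`)
correspond to `γμ ∈ A³`. Then `{γμ, γμ} = 0` in `A` if and only if `μ` satisfies the Jacobi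
identity `[a,[b,c]] = [[a,b],c] + [b,[a,c]]` for all `a, b, c ∈ V`. -/
theorem bracket_sq_zero_iff_jacobi
    (br : A k V →ₗ[k] A k V →ₗ[k] A k V) (hbr : IsBigBracket k V br)
    (br2 : V →ₗ[k] V →ₗ[k] V) (hskew : ∀ a b : V, br2 a b = -br2 b a)
    (γμ : A k V) (hγμ : RepresentsBracket k V br br2 γμ) :
    br γμ γμ = 0 ↔ LieJacobi k V br2 := by
  have key := hbr.ιV_apply_ιV_apply_ιV_apply_sq hγμ
  constructor
  · intro h a b c
    have h0 := key a b c
    rw [h, map_zero, map_zero, map_zero] at h0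
    have h1 := ιV_injective (h0.symm.trans (map_zero _).symm)
    exact (sub_eq_zero.1 ((smul_eq_zero.1 h1).resolve_left two_ne_zero)).symm
  · intro hJ
    have e3 := hbr.euler_apply_of_mem_muSpan hγμ.1 hγμ.1
    have e2 := hbr.euler_ιV_apply e3
    have e1 (a : V) := hbr.euler_ιV_apply (e2 a)
    refine eq_zero_of_euler_eq (by norm_num) e3 fun a =>
      eq_zero_of_euler_eq (by norm_num) (e2 a) fun b =>
        eq_zero_of_euler_eq (by norm_num) (e1 a b) fun c => ?_
    rw [key, hJ a b c, sub_self, smul_zero, map_zero]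

end BigBracket
end
end
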